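/- arXiv:2602.14220 — 9 statements merged into one kernel-verified Lean document; each statement's English description precedes it below -/
import Mathlib

section
/- Let N ≥ 1, let 𝒥 be an N×N real matrix, and let R be an even natural number with 2 ≤ R ≤ N (so R is strictly less than the dimension D = N + 1). There exists a skew-symmetric real matrix B̄ indexed by Unit ⊕ Fin N with rank B̄ = R whose associated 2-form is closed for the almost abelian bracket determined by 𝒥, if and only if there exists a skew-symmetric N×N real matrix B with B * 𝒥 + 𝒥ᵀ * B = 0 and (rank B = R or rank B = R − 2). -/
open Matrix

noncomputable section

/-- The matrix `𝒥̄` on `Unit ⊕ Fin N` with lower-right block `𝒥` and zeros elsewhere. -/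
def jbar {N : ℕ} (J : Matrix (Fin N) (Fin N) ℝ) :
    Matrix (Unit ⊕ Fin N) (Unit ⊕ Fin N) ℝ :=
  Matrix.fromBlocks 0 0 0 J

/-- The almost abelian Lie bracket determined by `𝒥`. -/
def aaBracket {N : ℕ} (J : Matrix (Fin N) (Fin N) ℝ)
    (x y : (Unit ⊕ Fin N) → ℝ) : (Unit ⊕ Fin N) → ℝ :=
  x (Sum.inl ()) • (jbar J).mulVec y - y (Sum.inl ()) • (jbar J).mulVec x

/-- The 2-form associated to a matrix `B̄`. -/
def twoForm {N : ℕ} (B : Matrix (Unit ⊕ Fin N) (Unit ⊕ Fin N) ℝ)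
    (x y : (Unit ⊕ Fin N) → ℝ) : ℝ :=
  x ⬝ᵥ B.mulVec y

/-- Closedness of the 2-form associated to `B̄` for the almost abelian bracket of `𝒥`. -/
def IsClosed2Form {N : ℕ} (J : Matrix (Fin N) (Fin N) ℝ)
    (B : Matrix (Unit ⊕ Fin N) (Unit ⊕ Fin N) ℝ) : Prop :=
  ∀ x y z : (Unit ⊕ Fin N) → ℝ,
    twoForm B x (aaBracket J y z) + twoForm B z (aaBracket J x y)
      + twoForm B y (aaBracket J z x) = 0


lemma rank_col_in {m n : Type} [Fintype m] [Fintype n] (c : m → ℝ) (M : Matrix m n ℝ)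
    (h : ∃ v, M *ᵥ v = c) : (fromCols (replicateCol Unit c) M).rank = M.rank := by
  rw [Matrix.rank_eq_finrank_span_cols, Matrix.rank_eq_finrank_span_cols]
  have e : Set.range (fromCols (replicateCol Unit c) M).col = insert c (Set.range M.col) := by
    ext x
    simp only [Set.mem_range, Sum.exists, Set.mem_insert_iff]
    refine or_congr ⟨fun ⟨_, h⟩ => h.symm, fun h => ⟨(), h.symm⟩⟩ Iff.rfl
  obtain ⟨v, rfl⟩ := h
  rw [e, Submodule.span_insert_eq_span]
  rw [← Matrix.range_mulVecLin]
  exact ⟨v, rfl⟩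

lemma rank_col_notin {m n : Type} [Fintype m] [Fintype n] (c : m → ℝ) (M : Matrix m n ℝ)
    (h : ¬ ∃ v, M *ᵥ v = c) : (fromCols (replicateCol Unit c) M).rank = M.rank + 1 := by
  rw [Matrix.rank_eq_finrank_span_cols, Matrix.rank_eq_finrank_span_cols]
  have e : Set.range (fromCols (replicateCol Unit c) M).col = insert c (Set.range M.col) := by
    ext x
    simp only [Set.mem_range, Sum.exists, Set.mem_insert_iff]
    refine or_congr ⟨fun ⟨_, h⟩ => h.symm, fun h => ⟨(), h.symm⟩⟩ Iff.rfl
  have hc : c ∉ Submodule.span ℝ (Set.range M.col) := by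
    rw [← Matrix.range_mulVecLin]
    exact h
  have hc0 : c ≠ 0 := by
    rintro rfl
    exact hc (Submodule.zero_mem _)
  have hd : Submodule.span ℝ {c} ⊓ Submodule.span ℝ (Set.range M.col) = ⊥ :=
    disjoint_iff.1 ((Submodule.disjoint_span_singleton' hc0).2 hc).symm
  have := Submodule.finrank_sup_add_finrank_inf_eq (Submodule.span ℝ {c})
    (Submodule.span ℝ (Set.range M.col))
  rw [hd, finrank_bot, finrank_span_singleton hc0] at this
  rw [e, Submodule.span_insert]
  omega

def mkBar {N : ℕ} (b : Fin N → ℝ) (B : Matrix (Fin N) (Fin N) ℝ) :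
    Matrix (Unit ⊕ Fin N) (Unit ⊕ Fin N) ℝ :=
  fromCols (replicateCol Unit (Sum.elim 0 b)) (fromRows (replicateRow Unit (-b)) B)

lemma mk_tr {N : ℕ} (b : Fin N → ℝ) (B : Matrix (Fin N) (Fin N) ℝ) (hB : Bᵀ = -B) :
    fromRows (replicateRow Unit (-b)) B = -(fromCols (replicateCol Unit b) B)ᵀ := by
  ext i j
  have := congrFun (congrFun hB j)
  rcases i with i | i
  · simp
  · have h2 := this i
    simp at h2
    simp
    linarith

lemma rank_neg' {m n : Type} [Fintype m] [Fintype n] (M : Matrix m n ℝ) :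
    (-M).rank = M.rank := by
  have : (-M).mulVecLin = -M.mulVecLin := by
    ext; simp
  rw [Matrix.rank, Matrix.rank, this, LinearMap.range_neg]

lemma skew_dot {N : ℕ} (B : Matrix (Fin N) (Fin N) ℝ) (hB : Bᵀ = -B) (v : Fin N → ℝ) :
    v ⬝ᵥ B *ᵥ v = 0 := by
  have h : v ⬝ᵥ B *ᵥ v = v ⬝ᵥ Bᵀ *ᵥ v := by
    rw [Matrix.mulVec_transpose, Matrix.dotProduct_mulVec, dotProduct_comm]
  rw [hB, neg_mulVec, dotProduct_neg] at h
  linarith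

lemma rank_mk_in {N : ℕ} (b : Fin N → ℝ) (B : Matrix (Fin N) (Fin N) ℝ) (hB : Bᵀ = -B)
    (h : ∃ v, B *ᵥ v = b) : (mkBar b B).rank = B.rank := by
  rw [mkBar, rank_col_in]
  · rw [mk_tr b B hB, rank_neg', rank_transpose, rank_col_in _ _ h]
  · obtain ⟨v, rfl⟩ := h
    refine ⟨v, ?_⟩
    rw [fromRows_mulVec]
    congr 1
    ext i
    have := skew_dot B hB v
    rw [dotProduct_comm] at this
    change -(B *ᵥ v) ⬝ᵥ v = 0
    rw [neg_dotProduct, this, neg_zero]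

lemma rank_mk_notin {N : ℕ} (b : Fin N → ℝ) (B : Matrix (Fin N) (Fin N) ℝ) (hB : Bᵀ = -B)
    (h : ¬ ∃ v, B *ᵥ v = b) : (mkBar b B).rank = B.rank + 2 := by
  rw [mkBar, rank_col_notin]
  · rw [mk_tr b B hB, rank_neg', rank_transpose, rank_col_notin _ _ h]
  · rintro ⟨v, hv⟩
    refine h ⟨v, ?_⟩
    rw [fromRows_mulVec] at hv
    ext i
    exact congrFun hv (Sum.inr i)

lemma mk_skew {N : ℕ} (b : Fin N → ℝ) (B : Matrix (Fin N) (Fin N) ℝ) (hB : Bᵀ = -B) :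
    (mkBar b B)ᵀ = -mkBar b B := by
  ext i j
  rcases i with i | i <;> rcases j with j | j
  · simp [mkBar]
  · simp [mkBar]
  · simp [mkBar]
  · simpa [mkBar] using congrFun (congrFun hB i) j

lemma exists_mk {N : ℕ} (A : Matrix (Unit ⊕ Fin N) (Unit ⊕ Fin N) ℝ) (hA : Aᵀ = -A) :
    ∃ b B, Bᵀ = -B ∧ A = mkBar b B := by
  have hs : ∀ i j, A j i = - A i j := fun i j => congrFun (congrFun hA i) j
  refine ⟨fun i => A (Sum.inr i) (Sum.inl ()), A.toBlocks₂₂, ?_, ?_⟩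
  · ext i j
    exact hs _ _
  · ext i j
    rcases i with i | i <;> rcases j with j | j
    · have := hs (Sum.inl i) (Sum.inl j)
      simp [mkBar]
      linarith
    · have := hs (Sum.inr j) (Sum.inl i)
      simpa [mkBar] using this
    · simp [mkBar]
    · simp [mkBar, toBlocks₂₂]

lemma bil_comm {N : ℕ} {B : Matrix (Fin N) (Fin N) ℝ} (hB : Bᵀ = -B)
    (J : Matrix (Fin N) (Fin N) ℝ) (x y : Fin N → ℝ) :
    x ⬝ᵥ B *ᵥ J *ᵥ y = - (y ⬝ᵥ (Jᵀ * B) *ᵥ x) := by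
  have : Jᵀ * B = - (B * J)ᵀ := by rw [transpose_mul, hB]; simp
  rw [this, neg_mulVec, dotProduct_neg, neg_neg, mulVec_transpose, mulVec_mulVec,
    dotProduct_mulVec, dotProduct_comm]

lemma twoForm_bracket {N : ℕ} (b : Fin N → ℝ) (B J : Matrix (Fin N) (Fin N) ℝ)
    (x y z : (Unit ⊕ Fin N) → ℝ) :
    twoForm (mkBar b B) x (aaBracket J y z) =
      y (Sum.inl ()) * (x (Sum.inl ()) * (-b ⬝ᵥ J *ᵥ (z ∘ Sum.inr))
        + (x ∘ Sum.inr) ⬝ᵥ B *ᵥ J *ᵥ (z ∘ Sum.inr))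
      - z (Sum.inl ()) * (x (Sum.inl ()) * (-b ⬝ᵥ J *ᵥ (y ∘ Sum.inr))
        + (x ∘ Sum.inr) ⬝ᵥ B *ᵥ J *ᵥ (y ∘ Sum.inr)) := by
  have key : ∀ w : (Unit ⊕ Fin N) → ℝ, x ⬝ᵥ mkBar b B *ᵥ (jbar J *ᵥ w) =
      x (Sum.inl ()) * (-b ⬝ᵥ J *ᵥ (w ∘ Sum.inr))
        + (x ∘ Sum.inr) ⬝ᵥ B *ᵥ J *ᵥ (w ∘ Sum.inr) := by
    intro w
    have h1 : jbar J *ᵥ w = Sum.elim (0 : Unit → ℝ) (J *ᵥ (w ∘ Sum.inr)) := by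
      rw [jbar, fromBlocks_mulVec]; simp
    have h2 : mkBar b B *ᵥ (jbar J *ᵥ w) = Sum.elim (fun _ => -b ⬝ᵥ J *ᵥ (w ∘ Sum.inr))
        (B *ᵥ J *ᵥ (w ∘ Sum.inr)) := by
      rw [h1, mkBar, fromCols_mulVec]
      simp only [Sum.elim_comp_inl, Sum.elim_comp_inr, mulVec_zero, zero_add, fromRows_mulVec]
      rfl
    rw [h2]
    simp [dotProduct, Fintype.sum_sum_type]
  rw [twoForm, aaBracket, mulVec_sub, mulVec_smul, mulVec_smul, dotProduct_sub, dotProduct_smul,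
    dotProduct_smul, key, key]
  rfl

lemma closed_iff {N : ℕ} (b : Fin N → ℝ) (B J : Matrix (Fin N) (Fin N) ℝ) (hB : Bᵀ = -B) :
    IsClosed2Form J (mkBar b B) ↔ B * J + Jᵀ * B = 0 := by
  constructor
  · intro h
    have key : ∀ u w : Fin N → ℝ, w ⬝ᵥ (B * J + Jᵀ * B) *ᵥ u = 0 := by
      intro u w
      have := h (Sum.elim 0 w) (Sum.elim 1 0) (Sum.elim 0 u)
      simp only [twoForm_bracket, Sum.elim_inl, Sum.elim_comp_inr, Pi.zero_apply,
        Pi.one_apply] at this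
      rw [bil_comm hB J u w] at this
      rw [add_mulVec, dotProduct_add, ← mulVec_mulVec]
      linarith
    refine Matrix.ext_of_mulVec_single fun j => ?_
    refine dotProduct_eq _ _ fun w => ?_
    rw [dotProduct_comm, key, zero_mulVec, zero_dotProduct]
  · intro h x y z
    have hJ : Jᵀ * B = - (B * J) := by
      rw [eq_neg_iff_add_eq_zero, add_comm, h]
    have hs : ∀ u v : Fin N → ℝ, u ⬝ᵥ B *ᵥ J *ᵥ v = v ⬝ᵥ B *ᵥ J *ᵥ u := by
      intro u v
      rw [bil_comm hB, hJ, neg_mulVec, dotProduct_neg, neg_neg, mulVec_mulVec]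
    simp only [twoForm_bracket]
    rw [hs (z ∘ Sum.inr) (x ∘ Sum.inr), hs (y ∘ Sum.inr) (x ∘ Sum.inr),
      hs (z ∘ Sum.inr) (y ∘ Sum.inr)]
    ring

/-- Existence of a presymplectic form of even rank `R < D = N+1` on the almost abelian Lie
algebra of `𝒥` iff there is a skew-symmetric `N×N` solution of `B𝒥 + 𝒥ᵀB = 0` of rank `R`
or `R - 2`. -/
theorem exists_presymplectic_iff
    (N : ℕ) (hN : 1 ≤ N) (J : Matrix (Fin N) (Fin N) ℝ)
    (R : ℕ) (hR : Even R) (hR2 : 2 ≤ R) (hRN : R ≤ N) :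
    (∃ Bbar : Matrix (Unit ⊕ Fin N) (Unit ⊕ Fin N) ℝ,
        Bbarᵀ = -Bbar ∧ Bbar.rank = R ∧ IsClosed2Form J Bbar) ↔
      (∃ B : Matrix (Fin N) (Fin N) ℝ,
        Bᵀ = -B ∧ B * J + Jᵀ * B = 0 ∧ (B.rank = R ∨ B.rank = R - 2)) := by
  constructor
  · rintro ⟨A, hA, hr, hc⟩
    obtain ⟨b, B, hB, rfl⟩ := exists_mk A hA
    refine ⟨B, hB, (closed_iff b B J hB).1 hc, ?_⟩
    by_cases h : ∃ v, B *ᵥ v = b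
    · left
      rw [← hr, rank_mk_in b B hB h]
    · right
      rw [← hr, rank_mk_notin b B hB h]
      rfl
  · rintro ⟨B, hB, hJ, hr | hr⟩
    · exact ⟨mkBar 0 B, mk_skew 0 B hB, by rw [rank_mk_in 0 B hB ⟨0, by simp⟩, hr],
        (closed_iff 0 B J hB).2 hJ⟩
    · have : ∃ b, ¬ ∃ v, B *ᵥ v = b := by
        by_contra! hcon
        have ht : LinearMap.range B.mulVecLin = ⊤ := LinearMap.range_eq_top.2 hcon
        rw [Matrix.rank, ht, finrank_top, Module.finrank_fin_fun] at hr
        omega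
      obtain ⟨b, hb⟩ := this
      exact ⟨mkBar b B, mk_skew b B hB, by rw [rank_mk_notin b B hB hb, hr]; omega,
        (closed_iff b B J hB).2 hJ⟩
end
end

section
/- Let A be an invertible n×n real matrix that has no negative real eigenvalue, i.e. for every real number t < 0 the matrix A − t • 1 is invertible. Then there exists a polynomial p with real coefficients such that (p evaluated at A)² = A⁻¹, i.e. (Polynomial.aeval A p) ^ 2 = A⁻¹. -/
open Matrix

open Polynomial in
lemma sq_mod_irred (p : ℝ[X]) (hp : Irreducible p) (h : ∀ t : ℝ, t ≤ 0 → p.eval t ≠ 0) :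
    ∃ q : ℝ[X], p ∣ q ^ 2 - X := by
  obtain ⟨z, hz⟩ := IsAlgClosed.exists_aeval_eq_zero ℂ p
    (fun h0 => hp.not_isUnit (Polynomial.isUnit_iff_degree_eq_zero.2 h0))
  suffices H : ∃ q : ℝ[X], (aeval z q) ^ 2 = z by
    obtain ⟨q, hq⟩ := H
    refine ⟨q, ?_⟩
    have h1 : p ∣ minpoly ℝ z := by
      have hd := minpoly.dvd ℝ z hz
      have hm : ¬ IsUnit (minpoly ℝ z) := minpoly.not_isUnit ℝ z
      obtain ⟨c, hc⟩ := hd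
      have hcu : IsUnit c := (hp.isUnit_or_isUnit hc).resolve_left hm
      rw [hc]
      exact (hcu.mul_right_dvd).2 dvd_rfl
    exact h1.trans (minpoly.dvd ℝ z (by simp [hq]))
  by_cases him : z.im = 0
  · have hzr : z = (z.re : ℂ) := by apply Complex.ext <;> simp [him]
    have hpos : 0 < z.re := by
      by_contra hc
      apply h z.re (not_lt.1 hc)
      rw [hzr] at hz
      have : aeval ((algebraMap ℝ ℂ) z.re) p = 0 := hz
      rw [aeval_algebraMap_apply] at this
      simpa using this
    refine ⟨C (Real.sqrt z.re), ?_⟩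
    rw [aeval_C]
    conv_rhs => rw [hzr]
    change ((Real.sqrt z.re : ℝ) : ℂ) ^ 2 = _
    rw [← Complex.ofReal_pow, Real.sq_sqrt hpos.le]
  · obtain ⟨w, hw⟩ := IsAlgClosed.exists_pow_nat_eq z (n := 2) (by norm_num)
    refine ⟨C (w.re - w.im / z.im * z.re) + C (w.im / z.im) * X, ?_⟩
    have : aeval z (C (w.re - w.im / z.im * z.re) + C (w.im / z.im) * X) = w := by
      rw [map_add, map_mul, aeval_C, aeval_C, aeval_X]
      change ((w.re - w.im / z.im * z.re : ℝ) : ℂ) + ((w.im / z.im : ℝ) : ℂ) * z = w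
      apply Complex.ext
      · rw [Complex.add_re, Complex.re_ofReal_mul, Complex.ofReal_re]; ring
      · rw [Complex.add_im, Complex.im_ofReal_mul, Complex.ofReal_im]; field_simp; ring
    rw [this, hw]

open Polynomial in
lemma sq_mod_pow (p : ℝ[X]) (hp : Irreducible p) (h : ∀ t : ℝ, t ≤ 0 → p.eval t ≠ 0) (k : ℕ) :
    ∃ q : ℝ[X], p ^ k ∣ q ^ 2 - X := by
  obtain ⟨q, hq⟩ := sq_mod_irred p hp h
  let I : Ideal ℝ[X] := Ideal.span {p ^ k}
  let f := Ideal.Quotient.mk I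
  have hfp : f p ^ k = 0 := by
    rw [← map_pow]; exact Ideal.Quotient.eq_zero_iff_mem.2 (Ideal.mem_span_singleton_self _)
  have hnil : IsNilpotent (f q ^ 2 - f X) := by
    obtain ⟨c, hc⟩ := hq
    refine ⟨k, ?_⟩
    rw [← map_pow, ← map_sub, hc, map_mul, mul_pow, hfp, zero_mul]
  have hcop : IsCoprime p X := by
    rw [hp.coprime_iff_not_dvd]
    intro hd
    obtain ⟨c, hc⟩ := hd
    have hX : Irreducible (X : ℝ[X]) := irreducible_X
    have h2 : X ∣ p := hp.associated_of_dvd hX ⟨c, hc⟩ |>.symm.dvd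
    obtain ⟨d, hd⟩ := h2
    exact h 0 le_rfl (by simp [hd])
  have hXu : IsUnit (f X) := by
    obtain ⟨a, b, hab⟩ := hcop.pow_left (m := k)
    have := congrArg f hab
    simp only [map_add, map_mul, map_pow, hfp, mul_zero, zero_add, map_one] at this
    exact IsUnit.of_mul_eq_one_right _ this
  have hqu : IsUnit (f q) := by
    have : IsUnit (f q ^ 2) := by
      have := hnil.isUnit_add_left_of_commute hXu (Commute.all _ _)
      simpa using this
    exact (isUnit_pow_iff two_ne_zero).1 this
  have h2u : IsUnit (2 : ℝ[X] ⧸ I) := by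
    have : IsUnit (algebraMap ℝ (ℝ[X] ⧸ I) 2) := (IsUnit.mk0 2 two_ne_zero).map _
    rwa [map_ofNat] at this
  obtain ⟨r, ⟨-, hr⟩, -⟩ := existsUnique_nilpotent_sub_and_aeval_eq_zero
    (R := ℝ[X] ⧸ I) (S := ℝ[X] ⧸ I) (P := X ^ 2 - C (f X)) (x := f q)
    (by simpa using hnil) (by simpa [one_add_one_eq_two] using And.intro h2u hqu)
  obtain ⟨g, rfl⟩ := Ideal.Quotient.mk_surjective r
  refine ⟨g, ?_⟩
  rw [← Ideal.mem_span_singleton, ← Ideal.Quotient.eq_zero_iff_mem]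
  simpa using hr

open Polynomial in
lemma sq_mod (m : ℝ[X]) : (∀ t : ℝ, t ≤ 0 → m.eval t ≠ 0) → ∃ q : ℝ[X], m ∣ q ^ 2 - X := by
  induction m using UniqueFactorizationMonoid.induction_on_coprime with
  | h0 => intro h; exact absurd (by simp) (h 0 le_rfl)
  | h1 hu => intro _; exact ⟨0, hu.dvd⟩
  | hpr i hp =>
    intro h
    rcases Nat.eq_zero_or_pos i with rfl | hi
    · exact ⟨0, by simp⟩
    · exact sq_mod_pow _ hp.irreducible (fun t ht h0 => h t ht (by simp [h0, hi.ne'])) i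
  | @hcp a b hc ha hb =>
    intro h
    obtain ⟨q, c, hq⟩ := ha (fun t ht h0 => h t ht (by simp [h0]))
    obtain ⟨r, d, hr⟩ := hb (fun t ht h0 => h t ht (by simp [h0]))
    obtain ⟨u, v, huv⟩ := hc.isCoprime
    refine ⟨q * (v * b) + r * (u * a), hc.isCoprime.mul_dvd ?_ ?_⟩
    · have : q * (v * b) + r * (u * a) = q + a * (u * (r - q)) := by
        linear_combination q * huv
      rw [this]
      exact ⟨c + u * (r - q) * (2 * q + a * (u * (r - q))), by linear_combination hq⟩
    · have : q * (v * b) + r * (u * a) = r + b * (v * (q - r)) := by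
        linear_combination r * huv
      rw [this]
      exact ⟨d + v * (q - r) * (2 * r + b * (v * (q - r))), by linear_combination hr⟩

/-- An invertible real matrix with no negative real eigenvalue has a polynomial square root
of its inverse. -/
theorem exists_polynomial_sqrt_inverse
    (n : ℕ) (A : Matrix (Fin n) (Fin n) ℝ) (hA : IsUnit A)
    (hneg : ∀ t : ℝ, t < 0 → IsUnit (A - t • (1 : Matrix (Fin n) (Fin n) ℝ))) :
    ∃ p : Polynomial ℝ, (Polynomial.aeval A p) ^ 2 = A⁻¹ := by
  have hroot : ∀ t : ℝ, t ≤ 0 → A.charpoly.eval t ≠ 0 := by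
    intro t ht
    have hu : IsUnit (A - t • (1 : Matrix (Fin n) (Fin n) ℝ)) := by
      rcases ht.lt_or_eq with h | rfl
      · exact hneg t h
      · simpa using hA
    have h2 := (Matrix.isUnit_iff_isUnit_det _).1 hu.neg
    rw [Matrix.eval_charpoly]
    have : Matrix.scalar (Fin n) t - A = -(A - t • (1 : Matrix (Fin n) (Fin n) ℝ)) := by
      rw [neg_sub, Matrix.smul_one_eq_diagonal]; rfl
    rw [this]
    exact h2.ne_zero
  obtain ⟨q, c, hq⟩ := sq_mod A.charpoly hroot
  have hqA : Polynomial.aeval A q ^ 2 = A := by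
    have := congrArg (Polynomial.aeval A) hq
    simp only [map_sub, map_pow, map_mul, Matrix.aeval_self_charpoly, zero_mul,
      Polynomial.aeval_X] at this
    exact sub_eq_zero.1 this
  have hcop : IsCoprime (Polynomial.X : Polynomial ℝ) A.charpoly := by
    rw [Polynomial.irreducible_X.coprime_iff_not_dvd]
    rintro ⟨d, hd⟩
    exact hroot 0 le_rfl (by simp [hd])
  obtain ⟨s, b, hs⟩ := hcop
  have hsA : Polynomial.aeval A s * A = 1 := by
    have := congrArg (Polynomial.aeval A) hs
    simpa [Matrix.aeval_self_charpoly] using this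
  have hinv : A⁻¹ = Polynomial.aeval A s := Matrix.inv_eq_left_inv hsA
  refine ⟨s * q, ?_⟩
  rw [hinv, ← map_pow, mul_pow, map_mul, map_pow _ q, hqA, map_pow, sq, mul_assoc, hsA, mul_one]
end

section
/- Let A be a skew-symmetric N×N real matrix of rank R such that every entry of A lies in {0, 1, −1} and every row and every column of A contains at most one nonzero entry (so that replacing each nonzero entry by its absolute value and deleting zero rows/columns yields a permutation pattern). Then R is even and there exists a permutation matrix P (the matrix of some permutation of Fin N) such that A = Pᵀ * J_{(N,R)} * P. -/
open Matrix

noncomputable section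

/-- The `n×n` real Jordan block with eigenvalue `λ` (0-based indices). -/
def jordanBlock (n : ℕ) (lam : ℝ) : Matrix (Fin n) (Fin n) ℝ :=
  Matrix.of fun i j => if j = i then lam else if (j : ℕ) = (i : ℕ) + 1 then 1 else 0

/-- The real Jordan block `C_n(a,b)` for a complex eigenvalue `a ± i b`, as a matrix of
`2×2` blocks indexed by `Fin n × Fin 2`. -/
def realJordanBlock (n : ℕ) (a b : ℝ) : Matrix (Fin n × Fin 2) (Fin n × Fin 2) ℝ :=
  Matrix.of fun p q =>
    if q.1 = p.1 then !![a, b; -b, a] p.2 q.2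
    else if (q.1 : ℕ) = (p.1 : ℕ) + 1 then (1 : Matrix (Fin 2) (Fin 2) ℝ) p.2 q.2
    else 0

/-- The canonical `2`-form of rank `R` (for `R` even, `R ≤ N`): the `N×N` matrix whose
top-left `R×R` block is `[[0, I_{R/2}], [-I_{R/2}, 0]]` and whose other entries vanish. -/
def canonJ (N R : ℕ) : Matrix (Fin N) (Fin N) ℝ :=
  Matrix.of fun i j =>
    if (i : ℕ) < R / 2 ∧ (j : ℕ) = (i : ℕ) + R / 2 then 1
    else if (j : ℕ) < R / 2 ∧ (i : ℕ) = (j : ℕ) + R / 2 then -1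
    else 0

/-- The permutation matrix of a permutation `σ` of `Fin N`. -/
def permMat {N : ℕ} (e : Equiv.Perm (Fin N)) : Matrix (Fin N) (Fin N) ℝ :=
  Matrix.of fun i j => if j = e i then 1 else 0

/-- A skew-symmetric matrix whose entries lie in `{0, 1, -1}` and which has at most one
nonzero entry in each row and column has even rank `R` and equals `Pᵀ J_{(N,R)} P` for some
permutation matrix `P`. -/
theorem skew_permutation_pattern_canonical
    (N R : ℕ) (A : Matrix (Fin N) (Fin N) ℝ)
    (hskew : Aᵀ = -A) (hrank : A.rank = R)
    (hentries : ∀ i j, A i j = 0 ∨ A i j = 1 ∨ A i j = -1)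
    (hrow : ∀ i j j', A i j ≠ 0 → A i j' ≠ 0 → j = j')
    (hcol : ∀ j i i', A i j ≠ 0 → A i' j ≠ 0 → i = i') :
    Even R ∧ ∃ e : Equiv.Perm (Fin N), A = (permMat e)ᵀ * canonJ N R * permMat e := by
  classical
  have hsk : ∀ i j, A j i = - A i j := fun i j => by
    have := congrFun (congrFun hskew i) j
    simpa using this
  let S := {i : Fin N // ∃ j, A i j = 1}
  let r := Fintype.card S
  let s : Fin r ≃ S := (Fintype.equivFin S).symm
  choose f hf using fun x : S => x.2
  let h : Fin r ⊕ Fin r → Fin N := Sum.elim (fun k => (s k).1) (fun k => f (s k))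
  have hst : ∀ x y : S, x.1 ≠ f y := by
    intro x y hxy
    have h1 := hf x
    have h2 := hf y
    rw [← hxy] at h2
    have h3 := hsk y.1 x.1
    rw [h2] at h3
    have h4 := hrow x.1 (f x) y.1 (by rw [h1]; norm_num) (by rw [h3]; norm_num)
    rw [← h4] at h3
    linarith
  have hinj : Function.Injective h := by
    rintro (a | a) (b | b) hab
    · simp only [h, Sum.elim_inl] at hab
      exact congrArg _ (s.injective (Subtype.ext hab))
    · exact absurd hab (hst _ _)
    · exact absurd hab.symm (hst _ _)
    · simp only [h, Sum.elim_inr] at hab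
      have h1 := hf (s a)
      have h2 := hf (s b)
      rw [hab] at h1
      have := hcol _ _ _ (by rw [h1]; norm_num) (by rw [h2]; norm_num)
      exact congrArg _ (s.injective (Subtype.ext this))
  have hone : ∀ i j, A i j = 1 → ∃ k, i = h (Sum.inl k) ∧ j = h (Sum.inr k) := by
    intro i j hij
    refine ⟨s.symm ⟨i, j, hij⟩, by simp [h], ?_⟩
    have h1 := hf ⟨i, j, hij⟩
    have := hrow i j _ (by rw [hij]; norm_num) (by rw [h1]; norm_num)
    simpa [h] using this
  have hval : ∀ k, A (h (Sum.inl k)) (h (Sum.inr k)) = 1 := fun k => hf (s k)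
  have hrk : A.rank = r + r := by
    have hD : A * Aᵀ = Matrix.diagonal (fun i => ∑ j, A i j * A i j) := by
      ext i k
      rw [Matrix.mul_apply]
      by_cases hik : i = k
      · subst hik; simp
      · rw [Matrix.diagonal_apply_ne _ hik]
        refine Finset.sum_eq_zero fun j _ => ?_
        by_contra hne
        rw [Matrix.transpose_apply] at hne
        exact hik (hcol j i k (left_ne_zero_of_mul hne) (right_ne_zero_of_mul hne))
    rw [← Matrix.rank_self_mul_transpose, hD, Matrix.rank_diagonal]
    have hiff : ∀ i, (∑ j, A i j * A i j) ≠ 0 ↔ i ∈ Set.range h := by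
      intro i
      rw [Ne, Finset.sum_eq_zero_iff_of_nonneg (fun j _ => mul_self_nonneg _)]
      simp only [Finset.mem_univ, true_imp_iff, mul_self_eq_zero, not_forall]
      constructor
      · rintro ⟨j, hj⟩
        rcases hentries i j with h0 | h1 | h1
        · exact absurd h0 hj
        · obtain ⟨k, hk, -⟩ := hone i j h1
          exact ⟨_, hk.symm⟩
        · obtain ⟨k, -, hk⟩ := hone j i (by rw [hsk i j, h1]; norm_num)
          exact ⟨_, hk.symm⟩
      · rintro ⟨k | k, rfl⟩
        · exact ⟨_, by rw [hval k]; norm_num⟩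
        · exact ⟨h (Sum.inl k), by rw [hsk, hval k]; norm_num⟩
    have e1 := (Equiv.ofInjective h hinj).trans (Equiv.subtypeEquivRight (fun i => (hiff i).symm))
    rw [← Fintype.card_congr e1]
    simp
  have hR : R = r + r := by rw [← hrank, hrk]
  have hR2 : R / 2 = r := by omega
  have hN : r + r ≤ N := by
    have := Fintype.card_le_of_injective h hinj
    simpa using this
  refine ⟨⟨r, hR⟩, ?_⟩
  let g : Fin r ⊕ Fin r → Fin N :=
    Sum.elim (fun k => ⟨k, by omega⟩) (fun k => ⟨k + r, by omega⟩)
  have hg : Function.Injective g := by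
    rintro (a | a) (b | b) hab <;> simp only [g, Sum.elim_inl, Sum.elim_inr, Fin.mk.injEq] at hab
    · exact congrArg _ (Fin.ext hab)
    · omega
    · omega
    · exact congrArg _ (Fin.ext (by omega))
  let e0 : {x // x ∈ Set.range g} ≃ {x // x ∈ Set.range h} :=
    (Equiv.ofInjective g hg).symm.trans (Equiv.ofInjective h hinj)
  let e : Equiv.Perm (Fin N) := e0.extendSubtype
  have heg : ∀ x, e (g x) = h x := by
    intro x
    have h1 := e0.extendSubtype_apply_of_mem (g x) ⟨x, rfl⟩
    have h2 : (Equiv.ofInjective g hg).symm ⟨g x, ⟨x, rfl⟩⟩ = x :=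
      Equiv.ofInjective_symm_apply hg x
    refine h1.trans ?_
    simp only [e0, Equiv.trans_apply]
    rw [h2]
    rfl
  have hone' : ∀ i j, A (e i) (e j) = 1 → (i : ℕ) < r ∧ (j : ℕ) = i + r := by
    intro i j hij
    obtain ⟨k, hk1, hk2⟩ := hone _ _ hij
    rw [← heg] at hk1 hk2
    rw [e.injective hk1, e.injective hk2]
    exact ⟨k.2, rfl⟩
  have hone2 : ∀ i j : Fin N, (i : ℕ) < r ∧ (j : ℕ) = i + r → A (e i) (e j) = 1 := by
    rintro i j ⟨h1, h2⟩
    have hi : e i = h (Sum.inl ⟨i, h1⟩) := heg (Sum.inl ⟨i, h1⟩)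
    have hj0 : j = g (Sum.inr ⟨i, h1⟩) := Fin.ext h2
    have hj : e j = h (Sum.inr ⟨i, h1⟩) := (congrArg e hj0).trans (heg _)
    rw [hj, hi]
    exact hval _
  have hmain : ∀ i j, A (e i) (e j) = canonJ N R i j := by
    intro i j
    simp only [canonJ, Matrix.of_apply, hR2]
    split_ifs with c1 c2
    · exact hone2 i j c1
    · rw [hsk, hone2 j i c2]
    · rcases hentries (e i) (e j) with h0 | h1 | h1
      · exact h0
      · exact absurd (hone' i j h1) c1
      · exact absurd (hone' j i (by rw [hsk, h1]; norm_num)) c2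
  refine ⟨e, ?_⟩
  ext a b
  obtain ⟨i, rfl⟩ := e.surjective a
  obtain ⟨j, rfl⟩ := e.surjective b
  rw [hmain]
  simp [Matrix.mul_apply, permMat, e.injective.eq_iff]
end
end

section
/- Let r, s ≥ 1 and let X : Matrix (Fin r) (Fin s) ℝ. Let J_r(0) and J_s(0) denote the nilpotent Jordan blocks of sizes r and s. Then X * J_s(0) + (J_r(0))ᵀ * X = 0 if and only if both of the following hold (0-based indices): (i) X i j = 0 whenever (i:ℕ) + (j:ℕ) + 2 ≤ max r s; and (ii) X i' j = −(X i j') whenever (i':ℕ) = (i:ℕ) + 1 ≤ r − 1 and (j':ℕ) = (j:ℕ) + 1 ≤ s − 1 (entries alternate in sign along anti-diagonals). In other words, the solutions are exactly the matrices of the form (0 over Y) with Y a lower alternating Hankel matrix. -/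
open Matrix

noncomputable section

lemma jb_apply (n : ℕ) (k j : Fin n) :
    jordanBlock n 0 k j = if (j : ℕ) = (k : ℕ) + 1 then 1 else 0 := by
  simp only [jordanBlock, Matrix.of_apply]
  by_cases h : j = k
  · subst h; simp
  · simp [h]

lemma mul_jb_zero {r s : ℕ} (X : Matrix (Fin r) (Fin s) ℝ) (i : Fin r) (j : Fin s)
    (hj : (j : ℕ) = 0) : (X * jordanBlock s 0) i j = 0 := by
  rw [Matrix.mul_apply]
  apply Finset.sum_eq_zero
  intro k _
  rw [jb_apply, if_neg (by omega), mul_zero]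

lemma mul_jb_succ {r s : ℕ} (X : Matrix (Fin r) (Fin s) ℝ) (i : Fin r) (j j' : Fin s)
    (hj : (j' : ℕ) = (j : ℕ) + 1) : (X * jordanBlock s 0) i j' = X i j := by
  rw [Matrix.mul_apply, Finset.sum_eq_single j]
  · rw [jb_apply, if_pos hj, mul_one]
  · intro k _ hk
    have : (k : ℕ) ≠ j := fun h => hk (Fin.ext h)
    rw [jb_apply, if_neg (by omega), mul_zero]
  · simp

lemma jbT_mul {r s : ℕ} (X : Matrix (Fin r) (Fin s) ℝ) (i : Fin r) (j : Fin s) :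
    ((jordanBlock r 0)ᵀ * X) i j = (Xᵀ * jordanBlock r 0) j i := by
  rw [← Matrix.transpose_apply ((jordanBlock r 0)ᵀ * X), Matrix.transpose_mul,
    Matrix.transpose_transpose]

/-- Solutions of `X J_s(0) + J_r(0)ᵀ X = 0` are exactly the lower alternating Hankel matrices. -/
theorem nilpotent_transpose_commutation_iff
    (r s : ℕ) (hr : 1 ≤ r) (hs : 1 ≤ s) (X : Matrix (Fin r) (Fin s) ℝ) :
    X * jordanBlock s 0 + (jordanBlock r 0)ᵀ * X = 0 ↔
      ((∀ (i : Fin r) (j : Fin s), (i : ℕ) + (j : ℕ) + 2 ≤ max r s → X i j = 0) ∧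
       (∀ (i i' : Fin r) (j j' : Fin s),
          (i' : ℕ) = (i : ℕ) + 1 → (j' : ℕ) = (j : ℕ) + 1 → X i' j = -(X i j'))) := by
  constructor
  · intro h
    have e : ∀ i j, (X * jordanBlock s 0) i j + (Xᵀ * jordanBlock r 0) j i = 0 := by
      intro i j
      rw [← jbT_mul, ← Matrix.add_apply, h, Matrix.zero_apply]
    have alt : ∀ (i i' : Fin r) (j j' : Fin s),
        (i' : ℕ) = (i : ℕ) + 1 → (j' : ℕ) = (j : ℕ) + 1 → X i' j = -(X i j') := by
      intro i i' j j' hi hj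
      have := e i' j'
      rw [mul_jb_succ X i' j j' hj, mul_jb_succ Xᵀ j' i i' hi, Matrix.transpose_apply] at this
      linarith
    refine ⟨?_, alt⟩
    have rowz : ∀ (n : ℕ) (i : Fin r) (j : Fin s), (i : ℕ) = n →
        (i : ℕ) + (j : ℕ) + 2 ≤ s → X i j = 0 := by
      intro n
      induction n with
      | zero =>
        intro i j hi hb
        have := e i ⟨j + 1, by omega⟩
        rwa [mul_jb_succ X i j _ rfl, mul_jb_zero Xᵀ _ i hi, add_zero] at this
      | succ n ih =>
        intro i j hi hb
        rw [alt ⟨n, by omega⟩ i j ⟨j + 1, by omega⟩ hi rfl, ih _ _ rfl (by simp only; omega),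
          neg_zero]
    have colz : ∀ (n : ℕ) (j : Fin s) (i : Fin r), (j : ℕ) = n →
        (i : ℕ) + (j : ℕ) + 2 ≤ r → X i j = 0 := by
      intro n
      induction n with
      | zero =>
        intro j i hj hb
        have := e ⟨i + 1, by omega⟩ j
        rwa [mul_jb_zero X _ j hj, mul_jb_succ Xᵀ j i _ rfl, zero_add,
          Matrix.transpose_apply] at this
      | succ n ih =>
        intro j i hj hb
        have h1 := alt i ⟨i + 1, by omega⟩ ⟨n, by omega⟩ j rfl hj
        rw [ih _ _ rfl (by simp only; omega)] at h1
        linarith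
    intro i j hb
    rcases le_max_iff.mp hb with h1 | h1
    · exact colz _ j i rfl h1
    · exact rowz _ i j rfl h1
  · rintro ⟨hz, alt⟩
    ext i j
    rw [Matrix.add_apply, jbT_mul, Matrix.zero_apply]
    have hrm := le_max_left r s
    have hsm := le_max_right r s
    by_cases hi : (i : ℕ) = 0
    · rw [mul_jb_zero Xᵀ j i hi, add_zero]
      by_cases hj : (j : ℕ) = 0
      · exact mul_jb_zero X i j hj
      · rw [mul_jb_succ X i ⟨j - 1, by omega⟩ j (by simp only; omega)]
        exact hz _ _ (by simp only; omega)
    · rw [mul_jb_succ Xᵀ j ⟨i - 1, by omega⟩ i (by simp only; omega), Matrix.transpose_apply]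
      by_cases hj : (j : ℕ) = 0
      · rw [mul_jb_zero X i j hj, zero_add]
        exact hz _ _ (by simp only; omega)
      · rw [mul_jb_succ X i ⟨j - 1, by omega⟩ j (by simp only; omega),
          alt ⟨i - 1, by omega⟩ i ⟨j - 1, by omega⟩ j (by simp only; omega) (by simp only; omega)]
        ring
end
end

section
/- Let p ≥ 1, let n : Fin p → ℕ with n i ≥ 1 for all i, let λ : Fin p → ℝ, let σ = Σ i, Fin (n i), and let 𝒥 = Matrix.blockDiagonal' (fun i => J_{n i}(λ i)) on σ. Suppose there exists a skew-symmetric real matrix B on σ with B * 𝒥 + 𝒥ᵀ * B = 0 and rank B = K. Then for every even natural number R with R ≤ K there exists a skew-symmetric real matrix B' on σ with B' * 𝒥 + 𝒥ᵀ * B' = 0 and rank B' = R. -/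
open Matrix

noncomputable section

theorem aux_rank_add_le {m n : Type*} [Fintype m] [Fintype n] (A C : Matrix m n ℝ) :
    (A + C).rank ≤ A.rank + C.rank := by
  unfold Matrix.rank
  rw [Matrix.mulVecLin_add]
  refine (Submodule.finrank_mono (LinearMap.range_add_le _ _)).trans ?_
  exact Submodule.finrank_add_le_finrank_add_finrank _ _

theorem aux_even_rank {m : Type*} [Fintype m] [DecidableEq m] (A : Matrix m m ℝ)
    (hA : Aᵀ = -A) : Even A.rank := by
  classical
  have hmem : ∀ x, A *ᵥ (A *ᵥ x) = 0 → A *ᵥ x = 0 := by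
    intro x hx
    have h1 : (A *ᵥ x) ⬝ᵥ (A *ᵥ x) = 0 := by
      rw [Matrix.dotProduct_mulVec, ← Matrix.mulVec_transpose, hA, Matrix.neg_mulVec, hx]
      simp
    exact dotProduct_self_eq_zero.1 h1
  let W := LinearMap.range A.mulVecLin
  let b := Module.finBasis ℝ W
  let P : Matrix m (Fin (Module.finrank ℝ W)) ℝ := Matrix.of fun i j => (b j : m → ℝ) i
  have hP : ∀ v, P *ᵥ v = ((∑ j, v j • b j : W) : m → ℝ) := by
    intro v
    ext i
    simp [P, Matrix.mulVec, dotProduct, mul_comm]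
  let M := Pᵀ * A * P
  have hM : Mᵀ = -M := by
    simp [M, Matrix.transpose_mul, hA, Matrix.mul_assoc]
  have hinj : ∀ v, M *ᵥ v = 0 → v = 0 := by
    intro v hv
    have hz : ∀ u, (P *ᵥ u) ⬝ᵥ (A *ᵥ (P *ᵥ v)) = 0 := by
      intro u
      have : (P *ᵥ u) ⬝ᵥ (A *ᵥ (P *ᵥ v)) = u ⬝ᵥ (M *ᵥ v) := by
        simp only [M, ← Matrix.mulVec_mulVec]
        rw [Matrix.dotProduct_mulVec u, Matrix.vecMul_transpose]
      rw [this, hv]; simp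
    have h2 : ∃ u, P *ᵥ u = A *ᵥ (P *ᵥ v) := by
      refine ⟨fun j => b.repr ⟨A *ᵥ (P *ᵥ v), ⟨_, rfl⟩⟩ j, ?_⟩
      rw [hP, b.sum_repr]
    obtain ⟨u, hu⟩ := h2
    have h3 := hz u
    rw [hu] at h3
    have h4 : A *ᵥ (P *ᵥ v) = 0 := dotProduct_self_eq_zero.1 h3
    have h5 : P *ᵥ v = 0 := by
      have hw : P *ᵥ v ∈ W := by rw [hP]; exact Subtype.property _
      obtain ⟨x, hx⟩ := hw
      have hx' : A *ᵥ x = P *ᵥ v := hx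
      rw [← hx'] at h4 ⊢
      exact hmem x h4
    rw [hP] at h5
    have h6 : (∑ j, v j • b j : W) = 0 := Subtype.ext h5
    have := Fintype.linearIndependent_iff.1 b.linearIndependent v h6
    exact funext this
  have hdet : M.det ≠ 0 := by
    intro h
    obtain ⟨v, hv, hv2⟩ := Matrix.exists_mulVec_eq_zero_iff.2 h
    exact hv (hinj v hv2)
  have h7 : M.det = (-1) ^ (Module.finrank ℝ W) * M.det := by
    conv_lhs => rw [← Matrix.det_transpose, hM, Matrix.det_neg, Fintype.card_fin]
  change Even (Module.finrank ℝ W)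
  rcases Nat.even_or_odd (Module.finrank ℝ W) with h | h
  · exact h
  · rw [h.neg_one_pow] at h7
    exact absurd (by linarith) hdet

def shiftS (m : ℕ) : Matrix (Fin m) (Fin m) ℝ :=
  Matrix.of fun i j => if (j : ℕ) = (i : ℕ) + 1 then 1 else 0

theorem shiftS_pow (m k : ℕ) (i j : Fin m) :
    (shiftS m ^ k) i j = if (j : ℕ) = (i : ℕ) + k then 1 else 0 := by
  induction k generalizing j with
  | zero => simp [Matrix.one_apply, Fin.ext_iff, eq_comm]
  | succ k ih =>
    rw [pow_succ, Matrix.mul_apply]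
    simp only [ih]
    by_cases h : (i : ℕ) + k < m
    · rw [Finset.sum_eq_single ⟨i + k, h⟩]
      · simp [shiftS, add_assoc]
      · intro x _ hx
        rw [if_neg (fun h' => hx (Fin.ext h'))]; simp
      · simp
    · rw [Finset.sum_eq_zero, if_neg (by omega)]
      intro x _
      rw [if_neg (by omega)]; simp

theorem shiftS_pow_self (m : ℕ) : shiftS m ^ m = 0 := by
  ext i j
  rw [shiftS_pow, if_neg (by omega)]; rfl

theorem jordanBlock_eq (m : ℕ) (l : ℝ) : jordanBlock m l = l • 1 + shiftS m := by
  ext i j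
  by_cases h : j = i
  · subst h; simp [jordanBlock, shiftS]
  · simp [jordanBlock, shiftS, h, Matrix.one_apply, Ne.symm h]

theorem shiftS_mul_transpose (m : ℕ) :
    shiftS (m + 1) * (shiftS (m + 1))ᵀ + Matrix.single (Fin.last m) (Fin.last m) 1 = 1 := by
  ext i j
  rw [Matrix.add_apply, Matrix.mul_apply]
  by_cases h : (i : ℕ) + 1 < m + 1
  · rw [Finset.sum_eq_single ⟨i + 1, h⟩]
    · have : Fin.last m ≠ i := by intro h'; subst h'; simp at h
      simp [shiftS, Matrix.single_apply, Matrix.one_apply, this, Fin.ext_iff]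
    · intro x _ hx
      have : ¬ (x : ℕ) = i + 1 := fun h' => hx (Fin.ext h')
      simp [shiftS, this]
    · simp
  · have hi : i = Fin.last m := Fin.ext (by simp; omega)
    subst hi
    rw [Finset.sum_eq_zero]
    · simp [Matrix.single_apply, Matrix.one_apply]
    · intro x _
      have : ¬ (x : ℕ) = m + 1 := by omega
      simp [shiftS, this]

theorem aux_step {m : Type*} [Fintype m] [DecidableEq m] (A Y Z : Matrix m m ℝ) (a : m)
    (h : Y * Z + Matrix.single a a 1 = 1) : A.rank ≤ (A * Y).rank + 1 := by
  have h1 : A = A * Y * Z + A * Matrix.single a a 1 := by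
    rw [Matrix.mul_assoc, ← Matrix.mul_add, h, Matrix.mul_one]
  have h2 : (Matrix.single a a (1 : ℝ)).rank ≤ 1 := by
    have : Matrix.single a a (1 : ℝ) = Matrix.vecMulVec (Pi.single a 1) (Pi.single a 1) := by
      ext x y
      simp only [Matrix.single_apply, Matrix.vecMulVec_apply, Pi.single_apply]
      grind
    rw [this]; exact Matrix.rank_vecMulVec_le _ _
  calc A.rank = (A * Y * Z + A * Matrix.single a a 1).rank := by rw [← h1]
    _ ≤ _ := aux_rank_add_le _ _
    _ ≤ _ := Nat.add_le_add (Matrix.rank_mul_le_left _ _) ((Matrix.rank_mul_le_right _ _).trans h2)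

theorem aux_step2 {m : Type*} [Fintype m] [DecidableEq m] (A Y Z : Matrix m m ℝ) (a : m)
    (h : Y * Z + Matrix.single a a 1 = 1) : A.rank ≤ (Yᵀ * A * Y).rank + 2 := by
  have h1 := aux_step Aᵀ Y Z a h
  have h2 := aux_step (Yᵀ * A) Y Z a h
  have h3 : (Aᵀ * Y).rank = (Yᵀ * A).rank := by
    rw [← Matrix.rank_transpose]; simp
  rw [Matrix.rank_transpose] at h1
  omega

theorem aux_Y {p : ℕ} (n : Fin p → ℕ) (hn : ∀ i, 1 ≤ n i) (i : Fin p) :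
    ∃ a Z, (Matrix.blockDiagonal' (fun j => shiftS (n j) ^ (if j = i then 1 else 0))) * Z
      + Matrix.single a a (1 : ℝ) = (1 : Matrix (Σ i, Fin (n i)) (Σ i, Fin (n i)) ℝ) := by
  have key : ∀ m, 1 ≤ m → ∃ a : Fin m, shiftS m * (shiftS m)ᵀ + Matrix.single a a 1 = 1 := by
    intro m hm
    obtain ⟨k, rfl⟩ := Nat.exists_eq_add_of_le' hm
    exact ⟨_, shiftS_mul_transpose k⟩
  obtain ⟨a, ha⟩ := key (n i) (hn i)
  refine ⟨⟨i, a⟩, Matrix.blockDiagonal' (fun j => (shiftS (n j) ^ (if j = i then 1 else 0))ᵀ), ?_⟩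
  rw [← Matrix.blockDiagonal'_mul]
  ext ⟨j, x⟩ ⟨k, y⟩
  by_cases hjk : j = k
  · subst hjk
    rw [Matrix.add_apply, Matrix.blockDiagonal'_apply_eq]
    by_cases hji : j = i
    · subst hji
      have := congrFun (congrFun ha x) y
      simpa [Matrix.single_apply, Matrix.one_apply] using this
    · have : i ≠ j := Ne.symm hji
      simp [hji, Matrix.single_apply, Matrix.one_apply, this]
  · rw [Matrix.add_apply, Matrix.blockDiagonal'_apply_ne _ _ _ hjk]
    have : ¬ (i = j ∧ i = k) := fun h => hjk (h.1.symm.trans h.2)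
    simp [Matrix.single_apply, Matrix.one_apply, hjk]
    rintro rfl _ rfl
    exact absurd rfl hjk

/-- From a skew-symmetric solution of `B𝒥 + 𝒥ᵀB = 0` of rank `K` one can construct
skew-symmetric solutions of every even rank `R ≤ K` (real-eigenvalue Jordan case). -/
theorem exists_lower_rank_solution_real
    (p : ℕ) (hp : 1 ≤ p) (n : Fin p → ℕ) (hn : ∀ i, 1 ≤ n i) (lam : Fin p → ℝ)
    (B : Matrix (Σ i, Fin (n i)) (Σ i, Fin (n i)) ℝ) (K : ℕ)
    (hskew : Bᵀ = -B)
    (heq : B * Matrix.blockDiagonal' (fun i => jordanBlock (n i) (lam i))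
        + (Matrix.blockDiagonal' (fun i => jordanBlock (n i) (lam i)))ᵀ * B = 0)
    (hrank : B.rank = K)
    (R : ℕ) (hR : Even R) (hRK : R ≤ K) :
    ∃ B' : Matrix (Σ i, Fin (n i)) (Σ i, Fin (n i)) ℝ,
      B'ᵀ = -B' ∧
      B' * Matrix.blockDiagonal' (fun i => jordanBlock (n i) (lam i))
        + (Matrix.blockDiagonal' (fun i => jordanBlock (n i) (lam i)))ᵀ * B' = 0 ∧
      B'.rank = R := by
  classical
  let Y : (Fin p → ℕ) → Matrix (Σ i, Fin (n i)) (Σ i, Fin (n i)) ℝ :=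
    fun t => Matrix.blockDiagonal' (fun j => shiftS (n j) ^ t j)
  set J := Matrix.blockDiagonal' (fun i => jordanBlock (n i) (lam i)) with hJ
  have hcomm : ∀ t, J * Y t = Y t * J := by
    intro t
    simp only [J, Y]
    rw [← Matrix.blockDiagonal'_mul, ← Matrix.blockDiagonal'_mul]
    congr 1
    funext j
    have : Commute (jordanBlock (n j) (lam j)) (shiftS (n j) ^ t j) := by
      rw [jordanBlock_eq]
      apply Commute.pow_right
      exact ((Commute.one_left _).smul_left _).add_left (Commute.refl _)
    exact this
  have hYadd : ∀ t s, Y (t + s) = Y t * Y s := by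
    intro t s
    simp only [Y]
    rw [← Matrix.blockDiagonal'_mul]
    congr 1
    funext j
    simp [pow_add]
  let C := fun t => (Y t)ᵀ * B * Y t
  have hCskew : ∀ t, (C t)ᵀ = -C t := by
    intro t
    simp [C, Matrix.transpose_mul, hskew, Matrix.mul_assoc]
  have hCeq : ∀ t, C t * J + Jᵀ * C t = 0 := by
    intro t
    have h1 : C t * J = (Y t)ᵀ * (B * J) * Y t := by
      simp only [C, Matrix.mul_assoc, hcomm]
    have h2 : Jᵀ * C t = (Y t)ᵀ * (Jᵀ * B) * Y t := by
      have : Jᵀ * (Y t)ᵀ = (Y t)ᵀ * Jᵀ := by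
        rw [← Matrix.transpose_mul, ← Matrix.transpose_mul, hcomm]
      simp only [C, ← Matrix.mul_assoc, this]
    rw [h1, h2, ← Matrix.add_mul, ← Matrix.mul_add, heq]
    simp
  have hstep : ∀ t i, (C t).rank ≤ (C (t + Pi.single i 1)).rank + 2 := by
    intro t i
    obtain ⟨a, Z, h⟩ := aux_Y n hn i
    have hY : Y (Pi.single i 1) = Matrix.blockDiagonal'
        (fun j => shiftS (n j) ^ (if j = i then 1 else 0)) := by
      simp only [Y, Pi.single_apply]
    rw [← hY] at h
    have := aux_step2 (C t) _ Z a h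
    have h2 : C (t + Pi.single i 1) = (Y (Pi.single i 1))ᵀ * C t * Y (Pi.single i 1) := by
      simp only [C, hYadd, Matrix.transpose_mul, Matrix.mul_assoc]
    rwa [h2]
  have hind : ∀ m t, ∑ i, t i = m → (C t).rank ≤ R → ∃ s, (C s).rank = R := by
    intro m
    induction m with
    | zero =>
      intro t ht hr
      have ht0 : t = 0 := by
        funext i
        simpa using (Finset.sum_eq_zero_iff.1 ht) i (Finset.mem_univ i)
      refine ⟨t, le_antisymm hr ?_⟩
      have : C t = B := by
        subst ht0
        have : Y 0 = 1 := by simp [Y]; exact Matrix.blockDiagonal'_one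
        simp [C, this]
      rw [this, hrank]; exact hRK
    | succ m ih =>
      intro t ht hr
      obtain ⟨i, _, hi⟩ : ∃ i ∈ Finset.univ, t i ≠ 0 := by
        apply Finset.exists_ne_zero_of_sum_ne_zero
        omega
      have hts : t = (t - Pi.single i 1) + Pi.single i 1 := by
        funext j
        by_cases hj : j = i
        · subst hj; simp; omega
        · simp [hj]
      by_cases hle : (C (t - Pi.single i 1)).rank ≤ R
      · refine ih _ ?_ hle
        have h3 : ∑ j, t j = ∑ j, (t - Pi.single i 1 : Fin p → ℕ) j + 1 := by
          conv_lhs => rw [hts]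
          simp [Finset.sum_add_distrib]
        omega
      · have h1 := hstep (t - Pi.single i 1) i
        rw [← hts] at h1
        have h2 := aux_even_rank _ (hCskew (t - Pi.single i 1))
        obtain ⟨x, hx⟩ := h2
        obtain ⟨y, hy⟩ := hR
        exact ⟨t, by omega⟩
  obtain ⟨s, hs⟩ := hind _ n rfl (by
    have : Y n = 0 := by
      simp only [Y, shiftS_pow_self]
      exact Matrix.blockDiagonal'_zero
    simp [C, this])
  exact ⟨C s, hCskew s, hCeq s, hs⟩
end
end

section
/- Let p ≥ 1, let n : Fin p → ℕ with n i ≥ 1 for all i, let λ : Fin p → ℝ, let σ = Σ i, Fin (n i), let N = Σ i, n i, and let 𝒥 = Matrix.blockDiagonal' (fun i => J_{n i}(λ i)) on σ. For μ > 0, let u₁ ≥ u₂ ≥ … and v₁ ≥ v₂ ≥ … be the block sizes n i with λ i = μ, respectively with λ i = −μ, each listed in decreasing order and padded with zeros so that both lists have the same length; set d(μ) := Σ_t |u_t − v_t|. Define the defect δ := Σ_{l odd} ((number of indices i with n i = l and λ i = 0) mod 2) + Σ_{μ > 0} d(μ) (a finite sum, as only finitely many μ occur among |λ i|). Then for every even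 natural number K: there exists a skew-symmetric real matrix B on σ with B * 𝒥 + 𝒥ᵀ * B = 0 and rank B = K if and only if K ≤ N − δ. -/
open Matrix

noncomputable section

/-- The list of elements of a multiset of naturals in decreasing order. -/
noncomputable def descList (u : Multiset ℕ) : List ℕ :=
  (u.sort (· ≤ ·)).reverse

/-- The Manhattan distance between two multisets of naturals, sorted in decreasing order and
padded with zeros to a common length (any `L` bounding both cardinalities gives the same
value; we sum over `Finset.range L`). -/
noncomputable def manhattanDist (L : ℕ) (u v : Multiset ℕ) : ℕ :=
  ∑ t ∈ Finset.range L, (((descList u).getD t 0 : ℤ) - ((descList v).getD t 0 : ℤ)).natAbs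

/-- The defect `δ` of a real-eigenvalue Jordan matrix: the number of unpairable odd-sized
nilpotent blocks plus, for each `μ > 0`, the Manhattan distance between the decreasingly
sorted lists of block sizes for the eigenvalues `μ` and `-μ`. -/
noncomputable def deltaReal (p : ℕ) (n : Fin p → ℕ) (lam : Fin p → ℝ) : ℕ :=
  (∑ l ∈ (Finset.range (∑ i, n i + 1)).filter (fun l => Odd l),
      (Finset.univ.filter (fun i => n i = l ∧ lam i = 0)).card % 2)
  + ∑ μ ∈ (Finset.univ.image fun i => |lam i|).filter (fun μ => 0 < μ),
      manhattanDist p ((Finset.univ.filter (fun i => lam i = μ)).val.map n)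
        ((Finset.univ.filter (fun i => lam i = -μ)).val.map n)

/-- The defect `δ` of a complex-eigenvalue real Jordan matrix. -/
noncomputable def deltaComplex (q : ℕ) (m : Fin q → ℕ) (a b : Fin q → ℝ) : ℕ :=
  2 * (∑ l ∈ (Finset.range (∑ j, m j + 1)).filter (fun l => Odd l),
      ∑ β ∈ (Finset.univ.image b).filter (fun β => 0 < β),
        (Finset.univ.filter (fun j => m j = l ∧ a j = 0 ∧ b j = β)).card % 2)
  + 2 * ∑ α ∈ (Finset.univ.image fun j => |a j|).filter (fun α => 0 < α),
      ∑ β ∈ (Finset.univ.image b).filter (fun β => 0 < β),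
        manhattanDist q ((Finset.univ.filter (fun j => a j = α ∧ b j = β)).val.map m)
          ((Finset.univ.filter (fun j => a j = -α ∧ b j = β)).val.map m)

theorem rank_add_le' {m : Type*} [Fintype m] [DecidableEq m] (A B : Matrix m m ℝ) :
    (A + B).rank ≤ A.rank + B.rank := by
  unfold Matrix.rank
  rw [Matrix.mulVecLin_add]
  refine le_trans (Submodule.finrank_mono (LinearMap.range_add_le _ _)) ?_
  exact Submodule.finrank_add_le_finrank_add_finrank _ _

theorem rank_sum_le' {m ι : Type*} [Fintype m] [DecidableEq m] (s : Finset ι)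
    (f : ι → Matrix m m ℝ) : (∑ i ∈ s, f i).rank ≤ ∑ i ∈ s, (f i).rank := by
  classical
  induction s using Finset.induction_on with
  | empty => simp
  | insert a s ha ih =>
    rw [Finset.sum_insert ha, Finset.sum_insert ha]
    exact (rank_add_le' _ _).trans (by omega)

theorem rank_smul_sign {m : Type*} [Fintype m] [DecidableEq m] (c : ℝ) (hc : c ≠ 0)
    (A : Matrix m m ℝ) : (c • A).rank = A.rank :=
  Matrix.rank_smul_of_mem_nonZeroDivisors A (mem_nonZeroDivisors_of_ne_zero hc)

theorem skew_rank_even {m : Type*} [Fintype m] [DecidableEq m] (S : Matrix m m ℝ)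
    (hS : Sᵀ = -S) : Even S.rank := by
  obtain ⟨V, U, e, hV, hU, h⟩ := Matrix.exists_rank_normal_form S
  generalize S.rank = r at *
  have hVd : IsUnit V.det := (Matrix.isUnit_iff_isUnit_det _).1 hV
  have hUd : IsUnit U.det := (Matrix.isUnit_iff_isUnit_det _).1 hU
  set Y : Matrix (Fin r ⊕ Fin (Fintype.card m - r)) (Fin r ⊕ Fin (Fintype.card m - r)) ℝ :=
    (Uᵀ * V⁻¹).submatrix e.symm e.symm with hY
  have hYd : Y.det ≠ 0 := by
    rw [hY, Matrix.det_submatrix_equiv_self, Matrix.det_mul, Matrix.det_transpose]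
    refine mul_ne_zero hUd.ne_zero ?_
    rw [Matrix.det_nonsing_inv]
    simpa using hVd.ne_zero
  have hT : (Uᵀ * S * U).submatrix e.symm e.symm = Y * fromBlocks 1 0 0 0 := by
    have : Uᵀ * S * U = Uᵀ * V⁻¹ * (V * S * U) := by
      have : V⁻¹ * (V * (S * U)) = S * U := by
        rw [← Matrix.mul_assoc, Matrix.nonsing_inv_mul _ hVd, Matrix.one_mul]
      simp only [Matrix.mul_assoc, this]
    rw [this, h, hY, ← Matrix.submatrix_mul_equiv _ _ _ e.symm _]
    congr 1
    ext i j
    simp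
  have hsk : ((Uᵀ * S * U).submatrix e.symm e.symm)ᵀ = -((Uᵀ * S * U).submatrix e.symm e.symm) := by
    rw [Matrix.transpose_submatrix]
    have : (Uᵀ * S * U)ᵀ = -(Uᵀ * S * U) := by
      rw [Matrix.transpose_mul, Matrix.transpose_mul, hS, Matrix.transpose_transpose]
      simp [Matrix.mul_assoc]
    rw [this]; rfl
  rw [hT, ← Matrix.fromBlocks_toBlocks Y, Matrix.fromBlocks_multiply] at hsk
  simp only [Matrix.fromBlocks_transpose, Matrix.fromBlocks_neg, Matrix.mul_one, Matrix.mul_zero,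
    add_zero, Matrix.fromBlocks_inj] at hsk
  obtain ⟨h1, h2, h3, h4⟩ := hsk
  have h21 : Y.toBlocks₂₁ = 0 := by
    have := congrArg Matrix.transpose h2
    simpa using this
  rw [← Matrix.fromBlocks_toBlocks Y, h21, Matrix.det_fromBlocks_zero₂₁] at hYd
  have h11 : Y.toBlocks₁₁.det ≠ 0 := left_ne_zero_of_mul hYd
  have := congrArg Matrix.det h1
  rw [Matrix.det_transpose, Matrix.det_neg, Fintype.card_fin] at this
  by_contra hodd
  rw [Nat.not_even_iff_odd] at hodd
  rw [hodd.neg_one_pow] at this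
  apply h11; linarith

section upper
variable {p : ℕ}

def NN (n : Fin p → ℕ) : Matrix (Σ i, Fin (n i)) (Σ i, Fin (n i)) ℝ :=
  Matrix.of fun x y => if x.1 = y.1 ∧ (y.2 : ℕ) = (x.2 : ℕ) + 1 then 1 else 0

def EE (n : Fin p → ℕ) (g : Fin p → ℝ) : Matrix (Σ i, Fin (n i)) (Σ i, Fin (n i)) ℝ :=
  Matrix.diagonal fun x => g x.1

theorem J_eq (n : Fin p → ℕ) (lam : Fin p → ℝ) :
    Matrix.blockDiagonal' (fun i => jordanBlock (n i) (lam i)) = EE n lam + NN n := by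
  ext ⟨i, a⟩ ⟨j, b⟩
  rw [Matrix.blockDiagonal'_apply]
  simp only [EE, NN, Matrix.add_apply, Matrix.diagonal_apply, Matrix.of_apply]
  by_cases h : i = j
  · subst h
    simp only [dite_true, cast_eq, jordanBlock, Matrix.of_apply, Sigma.mk.injEq, heq_eq_eq, true_and]
    by_cases hab : b = a
    · subst hab; simp
    · rw [if_neg hab, if_neg (Ne.symm hab)]; simp
  · simp [h]

theorem NN_pow_ne (n : Fin p → ℕ) (l : ℕ) (x y : Σ i, Fin (n i)) (h : ((NN n) ^ l) x y ≠ 0) :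
    x.1 = y.1 ∧ (y.2 : ℕ) = x.2 + l := by
  induction l generalizing y with
  | zero =>
    rw [pow_zero, Matrix.one_apply] at h
    have : x = y := by by_contra hh; simp [hh] at h
    subst this; simp
  | succ l ih =>
    rw [pow_succ, Matrix.mul_apply] at h
    obtain ⟨z, -, hz⟩ := Finset.exists_ne_zero_of_sum_ne_zero h
    have h1 := ih z (left_ne_zero_of_mul hz)
    have h2 := right_ne_zero_of_mul hz
    simp only [NN, Matrix.of_apply, ne_eq, ite_eq_right_iff, one_ne_zero, imp_false, not_not] at h2
    exact ⟨h1.1.trans h2.1, by omega⟩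

theorem NN_pow_zero (n : Fin p → ℕ) (l : ℕ) (hl : ∀ i, n i ≤ l) : (NN n) ^ l = 0 := by
  ext x y
  by_contra h
  have := NN_pow_ne n l x y h
  have h2 := y.2.isLt
  have := hl y.1
  omega

theorem NN_EE (n : Fin p → ℕ) (g : Fin p → ℝ) : NN n * EE n g = EE n g * NN n := by
  ext x y
  simp only [EE, Matrix.mul_diagonal, Matrix.diagonal_mul, NN, Matrix.of_apply]
  by_cases h : x.1 = y.1
  · rw [congrArg g h]; ring
  · simp [h]

theorem NN_pow_EE (n : Fin p → ℕ) (g : Fin p → ℝ) (l : ℕ) :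
    NN n ^ l * EE n g = EE n g * NN n ^ l :=
  (Commute.pow_left (NN_EE n g) l)

theorem NN_mul_transpose (n : Fin p → ℕ) :
    NN n * (NN n)ᵀ = Matrix.diagonal fun x => if (x.2 : ℕ) + 1 < n x.1 then (1 : ℝ) else 0 := by
  ext x y
  rw [Matrix.mul_apply, Matrix.diagonal_apply]
  by_cases hx : (x.2 : ℕ) + 1 < n x.1
  · rw [Finset.sum_eq_single ⟨x.1, ⟨x.2 + 1, hx⟩⟩]
    · simp only [NN, Matrix.of_apply, Matrix.transpose_apply, if_pos hx]
      by_cases hxy : x = y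
      · subst hxy; simp
      · have : ¬ (y.1 = x.1 ∧ (x.2 : ℕ) + 1 = y.2 + 1) := by
          rintro ⟨h1, h2⟩
          apply hxy
          obtain ⟨i, a⟩ := x
          obtain ⟨j, b⟩ := y
          dsimp at h1 h2
          subst h1
          congr 1
          exact Fin.ext (by omega)
        simp only [if_neg hxy, if_neg this, mul_zero]
    · intro z _ hz
      have : ¬ (x.1 = z.1 ∧ (z.2 : ℕ) = x.2 + 1) := by
        rintro ⟨h1, h2⟩
        apply hz
        obtain ⟨i, a⟩ := x
        obtain ⟨j, b⟩ := z
        dsimp at h1 h2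
        subst h1
        congr 1
        exact Fin.ext h2
      simp [NN, this]
    · simp
  · rw [Finset.sum_eq_zero]
    · simp [hx]
    · intro z _
      have : ¬ (x.1 = z.1 ∧ (z.2 : ℕ) = x.2 + 1) := by
        rintro ⟨h1, h2⟩
        apply hx
        have := z.2.isLt
        have h3 := congrArg n h1
        omega
      simp [NN, this]

def cc (n : Fin p → ℕ) (lam : Fin p → ℝ) (μ : ℝ) (l : ℕ) : ℕ :=
  (Finset.univ.filter (fun i => lam i = μ ∧ l < n i)).card

def chi (lam : Fin p → ℝ) (μ : ℝ) : Fin p → ℝ := fun i => if lam i = μ then 1 else 0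

theorem rank_step (n : Fin p → ℕ) (lam : Fin p → ℝ) (μ : ℝ) (l : ℕ)
    (B : Matrix (Σ i, Fin (n i)) (Σ i, Fin (n i)) ℝ) :
    (B * (NN n ^ l * EE n (chi lam μ))).rank ≤
      (B * (NN n ^ (l + 1) * EE n (chi lam μ))).rank + cc n lam μ l := by
  classical
  set T : Matrix (Σ i, Fin (n i)) (Σ i, Fin (n i)) ℝ :=
    Matrix.diagonal fun x => if lam x.1 = μ ∧ l < n x.1 ∧ (x.2 : ℕ) + 1 = n x.1 then 1 else 0 with hT
  have key : NN n ^ l * EE n (chi lam μ) =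
      (NN n ^ (l + 1) * EE n (chi lam μ)) * (NN n)ᵀ + NN n ^ l * T := by
    have h1 : (NN n ^ (l + 1) * EE n (chi lam μ)) * (NN n)ᵀ =
        NN n ^ l * (EE n (chi lam μ) * (NN n * (NN n)ᵀ)) := by
      rw [pow_succ, Matrix.mul_assoc (NN n ^ l), NN_EE]
      simp only [Matrix.mul_assoc]
    rw [h1, NN_mul_transpose, hT]
    ext x y
    simp only [EE, chi, Matrix.add_apply, Matrix.diagonal_mul_diagonal, Matrix.mul_diagonal]
    by_cases h0 : (NN n ^ l) x y = 0
    · simp [h0]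
    · have h2 := NN_pow_ne n l x y h0
      have h3 := y.2.isLt
      by_cases ha : lam y.1 = μ
      · by_cases hb : (y.2 : ℕ) + 1 < n y.1
        · have : ¬ ((y.2 : ℕ) + 1 = n y.1) := by omega
          simp [ha, hb, this]
        · have h4 : ((y.2 : ℕ) + 1 = n y.1) := by omega
          have h5 : l < n y.1 := by omega
          simp [ha, h4, h5]
      · simp [ha]
  have hTr : T.rank ≤ cc n lam μ l := by
    rw [hT, Matrix.rank_diagonal, Fintype.card_subtype, cc]
    refine Finset.card_le_card_of_injOn (fun x => x.1) ?_ ?_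
    · intro x hx
      simp at hx ⊢
      exact ⟨hx.1, hx.2.1⟩
    · rintro ⟨i, a⟩ hx ⟨j, b⟩ hy hxy
      simp at hx hy hxy
      subst hxy
      congr 1
      exact Fin.ext (by omega)
  calc (B * (NN n ^ l * EE n (chi lam μ))).rank
      = (B * (NN n ^ (l + 1) * EE n (chi lam μ)) * (NN n)ᵀ + B * NN n ^ l * T).rank := by
        conv_lhs => rw [key]
        rw [Matrix.mul_add]
        simp only [Matrix.mul_assoc]
    _ ≤ _ := (rank_add_le' _ _).trans (add_le_add (Matrix.rank_mul_le_left _ _)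
        ((Matrix.rank_mul_le_right _ _).trans hTr))

theorem B_vanish (n : Fin p → ℕ) (lam : Fin p → ℝ)
    (B : Matrix (Σ i, Fin (n i)) (Σ i, Fin (n i)) ℝ)
    (h : B * (EE n lam + NN n) + (EE n lam + NN n)ᵀ * B = 0) :
    ∀ (m : ℕ) (x y : Σ i, Fin (n i)), (x.2 : ℕ) + y.2 = m → lam x.1 + lam y.1 ≠ 0 → B x y = 0 := by
  intro m
  induction m using Nat.strong_induction_on with
  | _ m ih =>
    intro x y hm hl
    have he := congrFun (congrFun h x) y
    have e1 : (B * NN n) x y = 0 := by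
      rw [Matrix.mul_apply]
      refine Finset.sum_eq_zero fun z _ => ?_
      by_cases hz : z.1 = y.1 ∧ (y.2 : ℕ) = z.2 + 1
      · rw [ih (x.2 + z.2) (by omega) x z rfl (by rw [hz.1]; exact hl), zero_mul]
      · simp [NN, hz]
    have e2 : ((NN n)ᵀ * B) x y = 0 := by
      rw [Matrix.mul_apply]
      refine Finset.sum_eq_zero fun z _ => ?_
      by_cases hz : z.1 = x.1 ∧ (x.2 : ℕ) = z.2 + 1
      · rw [ih (z.2 + y.2) (by omega) z y rfl (by rw [hz.1]; exact hl), mul_zero]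
      · simp [NN, hz]
    simp only [Matrix.mul_add, Matrix.transpose_add, Matrix.add_mul, Matrix.add_apply, e1, e2] at he
    simp only [EE, Matrix.diagonal_transpose, Matrix.mul_diagonal, Matrix.diagonal_mul,
      Matrix.zero_apply, add_zero] at he
    have : (lam x.1 + lam y.1) * B x y = 0 := by linarith
    exact (mul_eq_zero.1 this).resolve_left hl

theorem B_EE (n : Fin p → ℕ) (lam : Fin p → ℝ)
    (B : Matrix (Σ i, Fin (n i)) (Σ i, Fin (n i)) ℝ)
    (h : B * (EE n lam + NN n) + (EE n lam + NN n)ᵀ * B = 0) (g g' : Fin p → ℝ)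
    (hg : ∀ i j, lam i + lam j = 0 → g i = g' j) : EE n g * B = B * EE n g' := by
  ext x y
  simp only [EE, Matrix.mul_diagonal, Matrix.diagonal_mul]
  by_cases hl : lam x.1 + lam y.1 = 0
  · rw [hg _ _ hl]; ring
  · rw [B_vanish n lam B h _ x y rfl hl]; ring

theorem B_NN (n : Fin p → ℕ) (lam : Fin p → ℝ)
    (B : Matrix (Σ i, Fin (n i)) (Σ i, Fin (n i)) ℝ)
    (h : B * (EE n lam + NN n) + (EE n lam + NN n)ᵀ * B = 0) :
    (NN n)ᵀ * B = - (B * NN n) := by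
  have h1 := B_EE n lam B h lam (fun i => - lam i) (fun i j hh => by linarith)
  have h2 : EE n (fun i => - lam i) = - EE n lam := by
    simp only [EE]; rw [Matrix.diagonal_neg]
  have h3 : (EE n lam)ᵀ = EE n lam := by simp [EE]
  rw [Matrix.mul_add, Matrix.transpose_add, Matrix.add_mul, h3, h1, h2, Matrix.mul_neg] at h
  have : B * NN n + (NN n)ᵀ * B = 0 := by rw [← h]; abel
  exact eq_neg_of_add_eq_zero_right this

theorem B_NN_pow (n : Fin p → ℕ) (lam : Fin p → ℝ)
    (B : Matrix (Σ i, Fin (n i)) (Σ i, Fin (n i)) ℝ)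
    (h : B * (EE n lam + NN n) + (EE n lam + NN n)ᵀ * B = 0) (l : ℕ) :
    ((NN n)ᵀ) ^ l * B = (-1 : ℝ) ^ l • (B * NN n ^ l) := by
  induction l with
  | zero => simp
  | succ l ih =>
    rw [pow_succ', Matrix.mul_assoc, ih, Matrix.mul_smul, ← Matrix.mul_assoc, B_NN n lam B h,
      pow_succ' (NN n), pow_succ, Matrix.neg_mul, Matrix.mul_assoc]
    simp

theorem X_transpose (n : Fin p → ℕ) (lam : Fin p → ℝ)
    (B : Matrix (Σ i, Fin (n i)) (Σ i, Fin (n i)) ℝ) (hB : Bᵀ = -B)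
    (h : B * (EE n lam + NN n) + (EE n lam + NN n)ᵀ * B = 0) (l : ℕ) (μ : ℝ) :
    (B * (NN n ^ l * EE n (chi lam μ)))ᵀ =
      (-(-1 : ℝ) ^ l) • (B * (NN n ^ l * EE n (chi lam (-μ)))) := by
  have h3 : (EE n (chi lam μ))ᵀ = EE n (chi lam μ) := by simp [EE]
  rw [Matrix.transpose_mul, Matrix.transpose_mul, hB, h3, Matrix.transpose_pow, Matrix.mul_neg,
    Matrix.mul_assoc, B_NN_pow n lam B h, Matrix.mul_smul, ← Matrix.mul_assoc,
    B_EE n lam B h (chi lam μ) (chi lam (-μ)), NN_pow_EE, Matrix.mul_assoc, neg_smul]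
  intro i j hij
  simp only [chi]
  have : lam i = μ ↔ lam j = -μ := by constructor <;> intro _ <;> linarith
  simp [this]

theorem X_rank_symm (n : Fin p → ℕ) (lam : Fin p → ℝ)
    (B : Matrix (Σ i, Fin (n i)) (Σ i, Fin (n i)) ℝ) (hB : Bᵀ = -B)
    (h : B * (EE n lam + NN n) + (EE n lam + NN n)ᵀ * B = 0) (l : ℕ) (μ : ℝ) :
    (B * (NN n ^ l * EE n (chi lam μ))).rank = (B * (NN n ^ l * EE n (chi lam (-μ)))).rank := by
  rw [← Matrix.rank_transpose, X_transpose n lam B hB h, rank_smul_sign]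
  simp

theorem X_rank_even (n : Fin p → ℕ) (lam : Fin p → ℝ)
    (B : Matrix (Σ i, Fin (n i)) (Σ i, Fin (n i)) ℝ) (hB : Bᵀ = -B)
    (h : B * (EE n lam + NN n) + (EE n lam + NN n)ᵀ * B = 0) (l : ℕ) :
    Even (B * (NN n ^ (2 * l) * EE n (chi lam 0))).rank := by
  apply skew_rank_even
  rw [X_transpose n lam B hB h, neg_zero]
  simp

end upper
theorem desc_count (w : List ℕ) (hw : w.Pairwise (· ≥ ·)) (l t : ℕ) :
    t < w.countP (fun x => decide (l < x)) ↔ l < w.getD t 0 := by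
  induction w generalizing t with
  | nil => simp
  | cons a w ih =>
    rw [List.pairwise_cons] at hw
    by_cases h : l < a
    · rw [List.countP_cons_of_pos (by simpa using h)]
      cases t with
      | zero => simp [h]
      | succ t => rw [List.getD_cons_succ, ← ih hw.2]; omega
    · have hz : ∀ x ∈ a :: w, x ≤ l := by
        intro x hx
        rcases List.mem_cons.1 hx with rfl | hx
        · omega
        · have := hw.1 x hx; omega
      have h0 : (a :: w).countP (fun x => decide (l < x)) = 0 := by
        rw [List.countP_eq_zero]
        intro x hx
        have := hz x hx
        simpa using this
      rw [h0]
      constructor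
      · omega
      · intro hh
        rw [List.getD_eq_getElem?_getD] at hh
        rcases hq : (a :: w)[t]? with _ | x
        · rw [hq] at hh; simp at hh
        · rw [hq] at hh
          have := hz x (List.mem_of_getElem? hq)
          simp at hh; omega

theorem descList_count (u : Multiset ℕ) (l t : ℕ) :
    t < u.countP (fun x => l < x) ↔ l < (descList u).getD t 0 := by
  rw [← desc_count]
  · have : (descList u : Multiset ℕ) = u := by
      rw [descList, Multiset.coe_reverse, Multiset.sort_eq]
    conv_lhs => rw [← this]
    rw [Multiset.coe_countP]
  · rw [descList, List.pairwise_reverse]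
    exact Multiset.pairwise_sort u (· ≤ ·)

theorem absd (m x y : ℕ) (hx : x ≤ m) (hy : y ≤ m) :
    ((x : ℤ) - (y : ℤ)).natAbs = ∑ l ∈ Finset.range m, if (l < x ↔ l < y) then 0 else 1 := by
  have : ∑ l ∈ Finset.range m, (if (l < x ↔ l < y) then 0 else 1) =
      ((Finset.range m).filter (fun l => ¬ (l < x ↔ l < y))).card := by
    rw [Finset.card_filter]
    refine Finset.sum_congr rfl fun l _ => ?_
    by_cases h : (l < x ↔ l < y) <;> simp [h]
  rw [this]
  have : (Finset.range m).filter (fun l => ¬ (l < x ↔ l < y)) = Finset.Ico (min x y) (max x y) := by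
    ext l; simp only [Finset.mem_filter, Finset.mem_range, Finset.mem_Ico]; omega
  rw [this, Nat.card_Ico]; omega

theorem manh_eq (L m : ℕ) (u v : Multiset ℕ) (hu : u.card ≤ L) (hv : v.card ≤ L)
    (hum : ∀ x ∈ u, x ≤ m) (hvm : ∀ x ∈ v, x ≤ m) :
    manhattanDist L u v = ∑ l ∈ Finset.range m,
      ((u.countP (fun x => l < x) : ℤ) - (v.countP (fun x => l < x) : ℤ)).natAbs := by
  have hle : ∀ (w : Multiset ℕ), (∀ x ∈ w, x ≤ m) → ∀ t, (descList w).getD t 0 ≤ m := by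
    intro w hw t
    by_contra hcon
    rw [not_le, ← descList_count] at hcon
    have : w.countP (fun x => m < x) = 0 := by
      rw [Multiset.countP_eq_zero]
      intro x hx; have := hw x hx; omega
    omega
  unfold manhattanDist
  rw [Finset.sum_congr rfl fun t _ => absd m _ _ (hle u hum t) (hle v hvm t), Finset.sum_comm]
  refine Finset.sum_congr rfl fun l _ => ?_
  rw [absd L _ _ ((Multiset.countP_le_card _ _).trans hu) ((Multiset.countP_le_card _ _).trans hv)]
  refine Finset.sum_congr rfl fun t _ => ?_
  simp only [descList_count]

theorem sum_layer {ι : Type*} (S : Finset ι) (n : ι → ℕ) (m : ℕ) (hm : ∀ i ∈ S, n i ≤ m) :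
    ∑ i ∈ S, n i = ∑ l ∈ Finset.range m, (S.filter (fun i => l < n i)).card := by
  simp only [Finset.card_filter]
  rw [Finset.sum_comm]
  refine Finset.sum_congr rfl fun i hi => ?_
  rw [← Finset.card_filter]
  have : (Finset.range m).filter (fun l => l < n i) = Finset.range (n i) := by
    ext l; have := hm i hi; simp; omega
  rw [this, Finset.card_range]

theorem manh_cc {p : ℕ} (n : Fin p → ℕ) (lam : Fin p → ℝ) (μ : ℝ) (m : ℕ) (hm : ∀ i, n i ≤ m) :
    manhattanDist p ((Finset.univ.filter (fun i => lam i = μ)).val.map n)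
        ((Finset.univ.filter (fun i => lam i = -μ)).val.map n)
      + 2 * ∑ l ∈ Finset.range m, min (cc n lam μ l) (cc n lam (-μ) l) =
    (∑ i ∈ Finset.univ.filter (fun i => lam i = μ), n i) +
    (∑ i ∈ Finset.univ.filter (fun i => lam i = -μ), n i) := by
  have hc : ∀ ν l, ((Finset.univ.filter (fun i => lam i = ν)).val.map n).countP (fun x => l < x)
      = cc n lam ν l := by
    intro ν l
    rw [Multiset.countP_map, cc, ← Finset.filter_filter]; rfl
  have hcard : ∀ ν, ((Finset.univ.filter (fun i => lam i = ν)).val.map n).card ≤ p := by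
    intro ν
    rw [Multiset.card_map]
    exact (Finset.card_le_univ _).trans (by simp)
  have hmm : ∀ ν, ∀ x ∈ ((Finset.univ.filter (fun i => lam i = ν)).val.map n), x ≤ m := by
    intro ν x hx
    obtain ⟨i, -, rfl⟩ := Multiset.mem_map.1 hx
    exact hm i
  rw [manh_eq p m _ _ (hcard _) (hcard _) (hmm _) (hmm _), sum_layer _ n m (fun i _ => hm i),
    sum_layer _ n m (fun i _ => hm i), Finset.mul_sum, ← Finset.sum_add_distrib,
    ← Finset.sum_add_distrib]
  refine Finset.sum_congr rfl fun l _ => ?_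
  rw [hc, hc, Finset.filter_filter, Finset.filter_filter]
  simp only [cc]
  omega

theorem class_sum {p : ℕ} (lam : Fin p → ℝ) {A : Type*} [AddCommMonoid A] (f : Fin p → A) :
    ∑ i, f i = (∑ i ∈ Finset.univ.filter (fun i => lam i = 0), f i) +
      ∑ μ ∈ (Finset.univ.image fun i => |lam i|).filter (fun μ => 0 < μ),
        ((∑ i ∈ Finset.univ.filter (fun i => lam i = μ), f i) +
         (∑ i ∈ Finset.univ.filter (fun i => lam i = -μ), f i)) := by
  rw [← Finset.sum_filter_add_sum_filter_not Finset.univ (fun i => lam i = 0)]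
  congr 1
  rw [← Finset.sum_fiberwise_of_maps_to (g := fun i => |lam i|)
    (t := (Finset.univ.image fun i => |lam i|).filter (fun μ => 0 < μ))]
  · refine Finset.sum_congr rfl fun μ hμ => ?_
    have hpos : 0 < μ := (Finset.mem_filter.1 hμ).2
    rw [← Finset.sum_union]
    · refine Finset.sum_congr ?_ fun _ _ => rfl
      ext i
      simp only [Finset.mem_filter, Finset.mem_univ, true_and, Finset.mem_union]
      rw [abs_eq hpos.le]
      constructor
      · rintro ⟨_, h⟩; exact h
      · intro h
        refine ⟨?_, h⟩
        rcases h with h | h <;> rw [h]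
        · exact hpos.ne'
        · exact (neg_neg_of_pos hpos).ne
    · rw [Finset.disjoint_left]
      intro i hi hi'
      simp only [Finset.mem_filter, Finset.mem_univ, true_and] at hi hi'
      linarith
  · intro i hi
    simp only [Finset.mem_filter, Finset.mem_univ, true_and, Finset.mem_image] at hi ⊢
    exact ⟨⟨i, rfl⟩, abs_pos.2 hi⟩

theorem chi_sum {p : ℕ} (lam : Fin p → ℝ) (i : Fin p) :
    (1 : ℝ) = chi lam 0 i +
      ∑ μ ∈ (Finset.univ.image fun i => |lam i|).filter (fun μ => 0 < μ),
        (chi lam μ i + chi lam (-μ) i) := by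
  have h := class_sum lam (fun j => if j = i then (1 : ℝ) else 0)
  have hc : ∀ ν, ∑ j ∈ Finset.univ.filter (fun j => lam j = ν), (if j = i then (1 : ℝ) else 0)
      = chi lam ν i := by
    intro ν
    rw [Finset.sum_ite_eq']
    simp [chi]
  simp only [hc] at h
  rw [← h]
  simp

theorem upper_zero {p : ℕ} (n : Fin p → ℕ) (lam : Fin p → ℝ)
    (B : Matrix (Σ i, Fin (n i)) (Σ i, Fin (n i)) ℝ) (hB : Bᵀ = -B)
    (h : B * (EE n lam + NN n) + (EE n lam + NN n)ᵀ * B = 0) (m : ℕ) (hm : ∀ i, n i ≤ m) :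
    (B * EE n (chi lam 0)).rank + (∑ l ∈ (Finset.range (m + 1)).filter (fun l => Odd l),
      (Finset.univ.filter (fun i => n i = l ∧ lam i = 0)).card % 2) ≤
      ∑ i ∈ Finset.univ.filter (fun i => lam i = 0), n i := by
  set r : ℕ → ℕ := fun l => (B * (NN n ^ l * EE n (chi lam 0))).rank with hr
  set q : ℕ → ℕ := fun l => (Finset.univ.filter (fun i => n i = l ∧ lam i = 0)).card % 2 with hq
  have hstep : ∀ l, r l ≤ r (l + 1) + cc n lam 0 l := fun l => rank_step n lam 0 l B
  have heven : ∀ j, Even (r (2 * j)) := X_rank_even n lam B hB h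
  have hcc : ∀ l, cc n lam 0 l = cc n lam 0 (l + 1) +
      (Finset.univ.filter (fun i => n i = l + 1 ∧ lam i = 0)).card := by
    intro l
    simp only [cc]
    rw [← Finset.card_union_of_disjoint]
    · congr 1
      ext i
      simp only [Finset.mem_filter, Finset.mem_univ, true_and, Finset.mem_union]
      constructor
      · rintro ⟨h1, h2⟩
        by_cases h3 : l + 1 < n i
        · exact Or.inl ⟨h1, h3⟩
        · exact Or.inr ⟨by omega, h1⟩
      · rintro (⟨h1, h2⟩ | ⟨h1, h2⟩)
        · exact ⟨h1, by omega⟩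
        · exact ⟨h2, by omega⟩
    · rw [Finset.disjoint_left]
      intro i hi hi'
      simp only [Finset.mem_filter, Finset.mem_univ, true_and] at hi hi'
      omega
  have hmain : ∀ J, r 0 + ∑ j ∈ Finset.range J, q (2 * j + 1) ≤
      r (2 * J) + ∑ l ∈ Finset.range (2 * J), cc n lam 0 l := by
    intro J
    induction J with
    | zero => simp
    | succ J ih =>
      rw [Finset.sum_range_succ, show 2 * (J + 1) = 2 * J + 1 + 1 by ring, Finset.sum_range_succ,
        Finset.sum_range_succ]
      have h1 := hstep (2 * J)
      have h2 := hstep (2 * J + 1)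
      have h3 := hcc (2 * J)
      have h4 : q (2 * J + 1) =
        (Finset.univ.filter (fun i => n i = 2 * J + 1 ∧ lam i = 0)).card % 2 := rfl
      obtain ⟨a, ha⟩ := heven J
      obtain ⟨b, hb⟩ := heven (J + 1)
      rw [show 2 * (J + 1) = 2 * J + 1 + 1 by ring] at hb
      omega
  have hz : r (2 * (m + 1)) = 0 := by
    simp only [hr]
    rw [NN_pow_zero n _ (fun i => (hm i).trans (by omega))]
    simp
  have h1 := hmain (m + 1)
  rw [hz] at h1
  have h2 : ∑ l ∈ Finset.range (2 * (m + 1)), cc n lam 0 l =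
      ∑ i ∈ Finset.univ.filter (fun i => lam i = 0), n i := by
    rw [sum_layer _ n (2 * (m + 1)) (fun i _ => (hm i).trans (by omega))]
    refine Finset.sum_congr rfl fun l _ => ?_
    rw [Finset.filter_filter]; rfl
  have h3 : ∑ l ∈ (Finset.range (m + 1)).filter (fun l => Odd l), q l ≤
      ∑ j ∈ Finset.range (m + 1), q (2 * j + 1) := by
    rw [← Finset.sum_image (f := q) (g := fun j => 2 * j + 1)]
    · refine Finset.sum_le_sum_of_subset ?_
      intro l hl
      simp only [Finset.mem_filter, Finset.mem_range, Finset.mem_image] at hl ⊢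
      obtain ⟨hl, k, hk⟩ := hl
      exact ⟨k, by omega, by omega⟩
    · intro a _ b _ hab
      simp only at hab; omega
  have h4 : r 0 = (B * EE n (chi lam 0)).rank := by simp [hr]
  rw [← h4]
  change r 0 + ∑ l ∈ (Finset.range (m + 1)).filter (fun l => Odd l), q l ≤ _
  omega

theorem upper_pos {p : ℕ} (n : Fin p → ℕ) (lam : Fin p → ℝ)
    (B : Matrix (Σ i, Fin (n i)) (Σ i, Fin (n i)) ℝ) (hB : Bᵀ = -B)
    (h : B * (EE n lam + NN n) + (EE n lam + NN n)ᵀ * B = 0) (m : ℕ) (hm : ∀ i, n i ≤ m)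
    (μ : ℝ) :
    (B * EE n (chi lam μ)).rank ≤ ∑ l ∈ Finset.range m, min (cc n lam μ l) (cc n lam (-μ) l) := by
  set r : ℕ → ℕ := fun l => (B * (NN n ^ l * EE n (chi lam μ))).rank with hr
  have hstep : ∀ l, r l ≤ r (l + 1) + cc n lam μ l := fun l => rank_step n lam μ l B
  have hstep' : ∀ l, r l ≤ r (l + 1) + cc n lam (-μ) l := by
    intro l
    simp only [hr]
    rw [X_rank_symm n lam B hB h l, X_rank_symm n lam B hB h (l + 1)]
    exact rank_step n lam (-μ) l B
  have hmain : ∀ J, r 0 ≤ r J + ∑ l ∈ Finset.range J, min (cc n lam μ l) (cc n lam (-μ) l) := by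
    intro J
    induction J with
    | zero => simp
    | succ J ih =>
      rw [Finset.sum_range_succ]
      have := hstep J
      have := hstep' J
      omega
  have hz : r m = 0 := by
    simp only [hr]
    rw [NN_pow_zero n _ hm]
    simp
  have h4 : r 0 = (B * EE n (chi lam μ)).rank := by simp [hr]
  have := hmain m
  rw [← h4]; omega

theorem upper_bound {p : ℕ} (n : Fin p → ℕ) (lam : Fin p → ℝ)
    (B : Matrix (Σ i, Fin (n i)) (Σ i, Fin (n i)) ℝ) (hB : Bᵀ = -B)
    (h : B * (EE n lam + NN n) + (EE n lam + NN n)ᵀ * B = 0) :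
    B.rank + deltaReal p n lam ≤ ∑ i, n i := by
  have hm : ∀ i, n i ≤ ∑ i, n i := fun i =>
    Finset.single_le_sum (f := n) (fun _ _ => Nat.zero_le _) (Finset.mem_univ i)
  set T := (Finset.univ.image fun i => |lam i|).filter (fun μ => 0 < μ) with hT
  have hdec : B = B * EE n (chi lam 0) +
      ∑ μ ∈ T, (B * EE n (chi lam μ) + B * EE n (chi lam (-μ))) := by
    ext x y
    simp only [Matrix.add_apply, Matrix.sum_apply, EE, Matrix.mul_diagonal]
    simp only [← mul_add, ← Finset.mul_sum]
    rw [← chi_sum, mul_one]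
  have h1 : B.rank ≤ (B * EE n (chi lam 0)).rank +
      ∑ μ ∈ T, 2 * ∑ l ∈ Finset.range (∑ i, n i), min (cc n lam μ l) (cc n lam (-μ) l) := by
    conv_lhs => rw [hdec]
    refine (rank_add_le' _ _).trans (Nat.add_le_add_left ?_ _)
    refine (rank_sum_le' _ _).trans (Finset.sum_le_sum fun μ _ => ?_)
    refine (rank_add_le' _ _).trans ?_
    have a := upper_pos n lam B hB h _ hm μ
    have b := X_rank_symm n lam B hB h 0 μ
    simp only [pow_zero, Matrix.one_mul] at b
    omega
  have h2 := upper_zero n lam B hB h _ hm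
  have h3 := class_sum lam n
  rw [← Finset.sum_congr rfl (fun μ _ => manh_cc n lam μ _ hm), Finset.sum_add_distrib] at h3
  unfold deltaReal
  rw [← hT] at h3 ⊢
  omega
section lower
variable {p : ℕ}

def Ach (n : Fin p → ℕ) (lam : Fin p → ℝ) (S : Finset (Fin p)) (M : ℕ) : Prop :=
  ∃ (τ : Fin p → Fin p) (k : Fin p → ℕ), (∀ i, τ (τ i) = i) ∧ (∀ i, k (τ i) = k i) ∧
    (∀ i, k i ≤ n i) ∧ (∀ i, k i ≠ 0 → lam (τ i) = - lam i) ∧ (∀ i, τ i = i → Even (k i)) ∧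
    (∀ i, i ∉ S → τ i = i ∧ k i = 0) ∧ ∑ i, k i = M

theorem Ach_zero (n : Fin p → ℕ) (lam : Fin p → ℝ) (S : Finset (Fin p)) : Ach n lam S 0 :=
  ⟨id, fun _ => 0, by simp⟩

theorem Ach_mono {n : Fin p → ℕ} {lam : Fin p → ℝ} {S S' : Finset (Fin p)} {M : ℕ}
    (h : Ach n lam S M) (hS : S ⊆ S') : Ach n lam S' M := by
  obtain ⟨τ, k, h1, h2, h3, h4, h5, h6, h7⟩ := h
  exact ⟨τ, k, h1, h2, h3, h4, h5, fun i hi => h6 i (fun h => hi (hS h)), h7⟩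

theorem Ach_single {n : Fin p → ℕ} {lam : Fin p → ℝ} (i : Fin p) (k : ℕ) (hi : lam i = 0)
    (hk : Even k) (hkn : k ≤ n i) : Ach n lam {i} k := by
  refine ⟨id, fun j => if j = i then k else 0, by simp, by simp, ?_, ?_, ?_, ?_, by simp⟩
  · intro j; dsimp only; split_ifs with h
    · rw [h]; exact hkn
    · simp
  · intro j hj
    have : j = i := by by_contra h; simp [h] at hj
    subst this; simp [hi]
  · intro j _; dsimp only; split_ifs
    · exact hk
    · simp
  · intro j hj
    have hj' : j ≠ i := by simpa using hj
    simp [hj']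

theorem Ach_pair {n : Fin p → ℕ} {lam : Fin p → ℝ} (i j : Fin p) (hij : i ≠ j) (k : ℕ)
    (hl : lam j = - lam i) (hi : k ≤ n i) (hj : k ≤ n j) : Ach n lam {i, j} (2 * k) := by
  refine ⟨Equiv.swap i j, fun t => if t = i ∨ t = j then k else 0, by simp, ?_, ?_, ?_, ?_, ?_, ?_⟩
  · intro t
    by_cases h1 : t = i
    · subst h1; simp
    by_cases h2 : t = j
    · subst h2; simp
    rw [Equiv.swap_apply_of_ne_of_ne h1 h2]
  · intro t; dsimp only; split_ifs with h
    · rcases h with h | h <;> rw [h] <;> assumption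
    · simp
  · intro t ht
    by_cases h1 : t = i
    · subst h1; simp [hl]
    by_cases h2 : t = j
    · subst h2; simp [hl]
    simp [h1, h2] at ht
  · intro t ht
    by_cases h1 : t = i
    · subst h1; simp at ht; exact absurd ht.symm hij
    by_cases h2 : t = j
    · subst h2; simp at ht; exact absurd ht hij
    simp [h1, h2]
  · intro t ht
    simp only [Finset.mem_insert, Finset.mem_singleton, not_or] at ht
    exact ⟨Equiv.swap_apply_of_ne_of_ne ht.1 ht.2, by simp [ht.1, ht.2]⟩
  · rw [← Finset.sum_filter]
    have : Finset.univ.filter (fun t => t = i ∨ t = j) = {i, j} := by ext; simp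
    rw [this, Finset.sum_pair hij]; ring

theorem Ach_union {n : Fin p → ℕ} {lam : Fin p → ℝ} {S S' : Finset (Fin p)} {M M' : ℕ}
    (hd : Disjoint S S') (h : Ach n lam S M) (h' : Ach n lam S' M') :
    Ach n lam (S ∪ S') (M + M') := by
  classical
  obtain ⟨τ, k, h1, h2, h3, h4, h5, h6, h7⟩ := h
  obtain ⟨τ', k', h1', h2', h3', h4', h5', h6', h7'⟩ := h'
  have hS : ∀ i, i ∈ S → τ i ∈ S := by
    intro i hi
    by_contra hc
    have := (h6 _ hc).1
    rw [h1] at this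
    rw [← this] at hc; exact hc hi
  have hS' : ∀ i, i ∉ S → τ' i ∉ S := by
    intro i hi hc
    by_cases hi' : τ' i ∈ S'
    · exact Finset.disjoint_left.1 hd hc hi'
    · have := (h6' _ hi').1
      rw [h1'] at this
      rw [← this] at hc; exact hi hc
  refine ⟨fun i => if i ∈ S then τ i else τ' i, fun i => if i ∈ S then k i else k' i,
    ?_, ?_, ?_, ?_, ?_, ?_, ?_⟩
  · intro i
    by_cases hi : i ∈ S
    · simp [hi, hS i hi, h1]
    · simp [hi, hS' i hi, h1']
  · intro i
    by_cases hi : i ∈ S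
    · simp [hi, hS i hi, h2]
    · simp [hi, hS' i hi, h2']
  · intro i; dsimp only; split_ifs
    · exact h3 i
    · exact h3' i
  · intro i; dsimp only; split_ifs
    · exact h4 i
    · exact h4' i
  · intro i; dsimp only; split_ifs
    · exact h5 i
    · exact h5' i
  · intro i hi
    rw [Finset.mem_union, not_or] at hi
    simp only [if_neg hi.1]
    exact h6' i hi.2
  · rw [← h7, ← h7', ← Finset.sum_add_distrib]
    refine Finset.sum_congr rfl fun i _ => ?_
    by_cases hi : i ∈ S
    · simp [hi, (h6' i (Finset.disjoint_left.1 hd hi)).2]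
    · simp [hi, (h6 i hi).2]

theorem Ach_biUnion {n : Fin p → ℕ} {lam : Fin p → ℝ} {β : Type*} [DecidableEq β]
    (S : β → Finset (Fin p)) (M : β → ℕ) (T : Finset β)
    (hd : ∀ a ∈ T, ∀ b ∈ T, a ≠ b → Disjoint (S a) (S b))
    (h : ∀ b ∈ T, Ach n lam (S b) (M b)) :
    Ach n lam (T.biUnion S) (∑ b ∈ T, M b) := by
  induction T using Finset.induction_on with
  | empty => simpa using Ach_zero n lam ∅
  | insert a T ha ih =>
    rw [Finset.biUnion_insert, Finset.sum_insert ha]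
    refine Ach_union ?_ (h a (Finset.mem_insert_self _ _)) (ih ?_ ?_)
    · rw [Finset.disjoint_biUnion_right]
      intro b hb
      exact hd a (Finset.mem_insert_self _ _) b (Finset.mem_insert_of_mem hb)
        (fun hh => ha (hh ▸ hb))
    · intro b hb c hc
      exact hd b (Finset.mem_insert_of_mem hb) c (Finset.mem_insert_of_mem hc)
    · intro b hb
      exact h b (Finset.mem_insert_of_mem hb)

theorem Ach_step {n : Fin p → ℕ} {lam : Fin p → ℝ} {S : Finset (Fin p)} {M : ℕ}
    (h : Ach n lam S M) (hM : 0 < M) : ∃ M', M = M' + 2 ∧ Ach n lam S M' := by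
  obtain ⟨τ, k, h1, h2, h3, h4, h5, h6, h7⟩ := h
  obtain ⟨i, hi⟩ : ∃ i, k i ≠ 0 := by
    by_contra hc
    push Not at hc
    simp [hc] at h7; omega
  set e : Fin p → ℕ := fun j => (if j = i then 1 else 0) + (if j = τ i then 1 else 0) with he
  have hinj : ∀ a b, τ a = τ b ↔ a = b := fun a b =>
    ⟨fun hh => by rw [← h1 a, hh, h1], fun hh => by rw [hh]⟩
  have hsw : ∀ a b, τ a = b ↔ a = τ b := fun a b => by
    rw [← hinj a (τ b), h1]
  have he1 : ∀ j, e (τ j) = e j := by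
    intro j
    simp only [he, hinj, hsw]; ring
  have he2 : ∀ j, e j ≤ k j := by
    intro j
    simp only [he]
    by_cases ha : j = i
    · subst ha
      by_cases hb : j = τ j
      · obtain ⟨c, hc⟩ := h5 j hb.symm
        simp [← hb]; omega
      · simp [hb]; omega
    · by_cases hb : j = τ i
      · have := h2 i
        rw [← hb] at this
        simp [ha, ← hb]; omega
      · simp [ha, hb]
  have he3 : ∀ j, τ j = j → Even (e j) := by
    intro j hj
    simp only [he]
    have : j = i ↔ j = τ i := by rw [← hsw, hj]
    by_cases ha : j = i
    · have hb := this.1 ha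
      rw [if_pos ha, if_pos hb]; decide
    · have hb := fun hh => ha (this.2 hh)
      rw [if_neg ha, if_neg hb]; decide
  have hs : ∑ j, (k j - e j) + 2 = M := by
    have h8 : ∑ j, e j = 2 := by
      simp only [he, Finset.sum_add_distrib, Finset.sum_ite_eq', Finset.mem_univ, if_true]
    rw [← h7, ← h8, ← Finset.sum_add_distrib]
    refine Finset.sum_congr rfl fun j _ => ?_
    have := he2 j; omega
  refine ⟨∑ j, (k j - e j), hs.symm, τ, fun j => k j - e j, h1, ?_, ?_, ?_, ?_, ?_, rfl⟩
  · intro j; simp only [h2, he1]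
  · intro j; have := h3 j; dsimp only; omega
  · intro j hj; exact h4 j (by dsimp only at hj; omega)
  · intro j hj
    exact (Nat.even_sub (he2 j)).2 (by simp [he3 j hj, h5 j hj])
  · intro j hj
    have := h6 j hj
    exact ⟨this.1, by simp [this.2]⟩

theorem Ach_even {n : Fin p → ℕ} {lam : Fin p → ℝ} {S : Finset (Fin p)} (M : ℕ)
    (h : Ach n lam S M) : Even M := by
  induction M using Nat.strong_induction_on with
  | _ M ih =>
    rcases Nat.eq_zero_or_pos M with rfl | hM
    · simp
    · obtain ⟨M', rfl, h'⟩ := Ach_step h hM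
      have := ih M' (by omega) h'
      exact this.add (by decide)

theorem Ach_le {n : Fin p → ℕ} {lam : Fin p → ℝ} {S : Finset (Fin p)} (M : ℕ)
    (h : Ach n lam S M) (K : ℕ) (hK : Even K) (hKM : K ≤ M) : Ach n lam S K := by
  induction M using Nat.strong_induction_on with
  | _ M ih =>
    rcases hKM.eq_or_lt with rfl | hlt
    · exact h
    · have he := Ach_even M h
      obtain ⟨M', rfl, h'⟩ := Ach_step h (by omega)
      refine ih M' (by omega) h' ?_
      obtain ⟨a, ha⟩ := hK
      obtain ⟨b, hb⟩ := he
      omega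

theorem Ach_fiber {n : Fin p → ℕ} {lam : Fin p → ℝ} (l c : ℕ) (S : Finset (Fin p))
    (hc : S.card = c) (hS : ∀ i ∈ S, lam i = 0 ∧ n i = l) :
    ∃ M, Ach n lam S M ∧ l * c ≤ M + (if Odd l then c % 2 else 0) := by
  induction c using Nat.strong_induction_on generalizing S with
  | _ c ih =>
    rcases Nat.lt_or_ge c 2 with h | h
    · interval_cases c
      · exact ⟨0, Ach_zero _ _ _, by simp⟩
      · obtain ⟨i, rfl⟩ := Finset.card_eq_one.1 hc
        have := hS i (Finset.mem_singleton_self i)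
        by_cases hl : Odd l
        · refine ⟨l - 1, Ach_single i _ this.1 ?_ (by omega), by simp [hl]; omega⟩
          obtain ⟨a, ha⟩ := hl
          exact ⟨a, by omega⟩
        · exact ⟨l, Ach_single i _ this.1 (Nat.not_odd_iff_even.1 hl) (by omega), by simp⟩
    · obtain ⟨i, hi, j, hj, hij⟩ := Finset.one_lt_card.1 (by omega : 1 < S.card)
      have hsub : {i, j} ⊆ S := by
        intro t ht
        rcases Finset.mem_insert.1 ht with rfl | ht
        · exact hi
        · rw [Finset.mem_singleton.1 ht]; exact hj
      obtain ⟨M, hM, hM'⟩ := ih (c - 2) (by omega) (S \ {i, j})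
        (by rw [Finset.card_sdiff_of_subset hsub, Finset.card_pair hij, hc])
        (fun t ht => hS t (Finset.mem_sdiff.1 ht).1)
      have hp := Ach_pair (n := n) (lam := lam) i j hij l
        (by rw [(hS i hi).1, (hS j hj).1, neg_zero])
        (hS i hi).2.ge (hS j hj).2.ge
      have hu := Ach_union Finset.disjoint_sdiff hp hM
      rw [Finset.union_sdiff_of_subset hsub] at hu
      refine ⟨_, hu, ?_⟩
      obtain ⟨d, rfl⟩ := Nat.exists_eq_add_of_le h
      rw [Nat.add_sub_cancel_left] at hM'
      have : (2 + d) % 2 = d % 2 := by omega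
      rw [this, Nat.mul_add]
      omega

theorem Ach_greedy {n : Fin p → ℕ} {lam : Fin p → ℝ} (μ : ℝ) (hμ : 0 < μ) (m : ℕ)
    (c : ℕ) (U V : Finset (Fin p)) (hc : U.card = c) (hU : ∀ i ∈ U, lam i = μ)
    (hV : ∀ i ∈ V, lam i = -μ) (hm : ∀ i, n i ≤ m) :
    Ach n lam (U ∪ V) (2 * ∑ l ∈ Finset.range m,
      min (U.filter (fun i => l < n i)).card (V.filter (fun i => l < n i)).card) := by
  induction c generalizing U V with
  | zero =>
    rw [Finset.card_eq_zero] at hc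
    subst hc
    simpa using Ach_zero n lam V
  | succ c ih =>
    rcases V.eq_empty_or_nonempty with rfl | hVne
    · simpa using Ach_zero n lam U
    have hUne : U.Nonempty := Finset.card_pos.1 (by omega)
    obtain ⟨i, hi, hi'⟩ := Finset.exists_max_image U n hUne
    obtain ⟨j, hj, hj'⟩ := Finset.exists_max_image V n hVne
    have hij : i ≠ j := by
      rintro rfl
      have := hU _ hi; have := hV _ hj; linarith
    have h1 := ih (U.erase i) (V.erase j) (by rw [Finset.card_erase_of_mem hi]; omega)
      (fun t ht => hU t (Finset.mem_of_mem_erase ht)) (fun t ht => hV t (Finset.mem_of_mem_erase ht))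
    have h2 := Ach_pair (n := n) (lam := lam) i j hij (min (n i) (n j))
      (by rw [hU i hi, hV j hj]) (min_le_left _ _) (min_le_right _ _)
    have hiV : i ∉ V := fun hh => by
      have := hU _ hi; have := hV _ hh; linarith
    have hjU : j ∉ U := fun hh => by
      have := hV _ hj; have := hU _ hh; linarith
    have hd : Disjoint {i, j} (U.erase i ∪ V.erase j) := by
      rw [Finset.disjoint_left]
      intro t ht
      rcases Finset.mem_insert.1 ht with rfl | ht
      · simp [hiV]
      · rw [Finset.mem_singleton.1 ht]; simp [hjU]
    have h3 := Ach_union hd h2 h1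
    have hsum : ∑ l ∈ Finset.range m,
        min (U.filter (fun i => l < n i)).card (V.filter (fun i => l < n i)).card =
        min (n i) (n j) + ∑ l ∈ Finset.range m, min ((U.erase i).filter (fun i => l < n i)).card
          ((V.erase j).filter (fun i => l < n i)).card := by
      have h4 : min (n i) (n j) = ∑ l ∈ Finset.range m, if l < min (n i) (n j) then 1 else 0 := by
        rw [← Finset.card_filter]
        have : (Finset.range m).filter (fun l => l < min (n i) (n j)) =
            Finset.range (min (n i) (n j)) := by
          ext l; have := hm i; simp only [Finset.mem_filter, Finset.mem_range]; omega
        rw [this, Finset.card_range]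
      conv_rhs => rw [h4]
      rw [← Finset.sum_add_distrib]
      refine Finset.sum_congr rfl fun l _ => ?_
      have key : ∀ (W : Finset (Fin p)) (w : Fin p), w ∈ W → (∀ x ∈ W, n x ≤ n w) →
          (l < n w ∧ (W.filter (fun i => l < n i)).card =
            ((W.erase w).filter (fun i => l < n i)).card + 1) ∨
          (¬ l < n w ∧ (W.filter (fun i => l < n i)).card = 0 ∧
            ((W.erase w).filter (fun i => l < n i)).card = 0) := by
        intro W w hw hmax
        by_cases hl : l < n w
        · left
          refine ⟨hl, ?_⟩
          rw [Finset.filter_erase, Finset.card_erase_add_one]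
          exact Finset.mem_filter.2 ⟨hw, hl⟩
        · right
          have : W.filter (fun i => l < n i) = ∅ := by
            rw [Finset.filter_eq_empty_iff]
            intro x hx; have := hmax x hx; omega
          refine ⟨hl, by rw [this]; rfl, ?_⟩
          rw [Finset.filter_erase, this]; rfl
      have k1 := key U i hi hi'
      have k2 := key V j hj hj'
      split_ifs <;> omega
    rw [hsum, Nat.mul_add]
    refine Ach_mono h3 ?_
    intro t ht
    simp only [Finset.mem_union, Finset.mem_insert, Finset.mem_singleton, Finset.mem_erase] at ht ⊢
    rcases ht with (rfl | rfl) | ⟨_, h⟩ | ⟨_, h⟩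
    · exact Or.inl hi
    · exact Or.inr hj
    · exact Or.inl h
    · exact Or.inr h

theorem Ach_zero_part (n : Fin p → ℕ) (lam : Fin p → ℝ) (m : ℕ) (hm : ∀ i, n i ≤ m) :
    ∃ M, Ach n lam (Finset.univ.filter (fun i => lam i = 0)) M ∧
      ∑ i ∈ Finset.univ.filter (fun i => lam i = 0), n i ≤
      M + (∑ l ∈ (Finset.range (m + 1)).filter (fun l => Odd l),
      (Finset.univ.filter (fun i => n i = l ∧ lam i = 0)).card % 2) := by
  set F : ℕ → Finset (Fin p) := fun l => Finset.univ.filter (fun i => n i = l ∧ lam i = 0) with hF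
  have hex : ∀ l, ∃ M, Ach n lam (F l) M ∧
      l * (F l).card ≤ M + (if Odd l then (F l).card % 2 else 0) := fun l =>
    Ach_fiber l _ (F l) rfl (fun i hi => by
      simp only [hF, Finset.mem_filter] at hi; exact ⟨hi.2.2, hi.2.1⟩)
  choose M hM hM' using hex
  refine ⟨∑ l ∈ Finset.range (m + 1), M l, Ach_mono
    (Ach_biUnion F M (Finset.range (m + 1)) ?_ (fun l _ => hM l)) ?_, ?_⟩
  · intro a _ b _ hab
    rw [Finset.disjoint_left]
    intro i hi hi'
    simp only [hF, Finset.mem_filter] at hi hi'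
    omega
  · intro i hi
    simp only [hF, Finset.mem_biUnion, Finset.mem_filter, Finset.mem_univ, true_and] at hi ⊢
    obtain ⟨_, _, _, h⟩ := hi
    exact h
  · rw [Finset.sum_filter (fun l => Odd l), ← Finset.sum_add_distrib]
    rw [← Finset.sum_fiberwise_of_maps_to (g := n) (t := Finset.range (m + 1))]
    · refine Finset.sum_le_sum fun l _ => ?_
      refine le_trans (le_of_eq ?_) (hM' l)
      rw [Finset.filter_filter, Finset.sum_congr rfl (g := fun _ => l), Finset.sum_const,
        smul_eq_mul, mul_comm]
      · congr 2
        ext i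
        simp only [hF, Finset.mem_filter, Finset.mem_univ, true_and]
        exact and_comm
      · intro i hi
        exact (Finset.mem_filter.1 hi).2.2
    · intro i _
      have := hm i
      simp; omega

theorem Ach_total (n : Fin p → ℕ) (lam : Fin p → ℝ) :
    ∃ M, Ach n lam Finset.univ M ∧ ∑ i, n i ≤ M + deltaReal p n lam := by
  have hm : ∀ i, n i ≤ ∑ i, n i := fun i =>
    Finset.single_le_sum (f := n) (fun _ _ => Nat.zero_le _) (Finset.mem_univ i)
  obtain ⟨M0, h0, h0'⟩ := Ach_zero_part n lam _ hm
  set T := (Finset.univ.image fun i => |lam i|).filter (fun μ => 0 < μ) with hT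
  have h1 := Ach_biUnion (n := n) (lam := lam) (fun μ : ℝ => Finset.univ.filter (fun i => lam i = μ) ∪
      Finset.univ.filter (fun i => lam i = -μ))
    (fun μ => 2 * ∑ l ∈ Finset.range (∑ i, n i), min (cc n lam μ l) (cc n lam (-μ) l)) T ?_ ?_
  · refine ⟨_, Ach_mono (Ach_union ?_ h0 h1) (Finset.subset_univ _), ?_⟩
    · rw [Finset.disjoint_left]
      intro i hi hi'
      simp only [Finset.mem_filter, Finset.mem_univ, true_and, Finset.mem_biUnion,
        Finset.mem_union] at hi hi'
      obtain ⟨μ, hμ, h⟩ := hi'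
      have := (Finset.mem_filter.1 hμ).2
      rcases h with h | h <;> linarith
    · have h3 := class_sum lam n
      rw [← Finset.sum_congr rfl (fun μ _ => manh_cc n lam μ _ hm), Finset.sum_add_distrib] at h3
      unfold deltaReal
      rw [← hT] at h3 ⊢
      omega
  · intro a ha b hb hab
    have ha := (Finset.mem_filter.1 ha).2
    have hb := (Finset.mem_filter.1 hb).2
    rw [Finset.disjoint_left]
    intro i hi hi'
    simp only [Finset.mem_filter, Finset.mem_univ, true_and, Finset.mem_union] at hi hi'
    rcases hi with h | h <;> rcases hi' with h' | h'
    · exact hab (h.symm.trans h')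
    · linarith
    · linarith
    · exact hab (by linarith)
  · intro μ hμ
    have := Ach_greedy (n := n) (lam := lam) μ (Finset.mem_filter.1 hμ).2 _ _
      (Finset.univ.filter (fun i => lam i = μ)) (Finset.univ.filter (fun i => lam i = -μ)) rfl
      (by simp) (by simp) hm
    simp only [Finset.filter_filter] at this
    exact this

end lower
section construct
variable {p : ℕ}

def bmat (n : Fin p → ℕ) (τ : Fin p → Fin p) (k : Fin p → ℕ) (ε : Fin p → ℝ) :
    Matrix (Σ i, Fin (n i)) (Σ i, Fin (n i)) ℝ :=
  Matrix.of fun x y => if y.1 = τ x.1 ∧ (x.2 : ℕ) + y.2 + k x.1 + 1 = n x.1 + n y.1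
    then ε x.1 * (-1) ^ (x.2 : ℕ) else 0

theorem bmat_mul_NN (n : Fin p → ℕ) (τ : Fin p → Fin p) (k : Fin p → ℕ) (ε : Fin p → ℝ)
    (hk : ∀ i, k i ≤ n i) (hkτ : ∀ i, k (τ i) = k i) (x y : Σ i, Fin (n i)) :
    (bmat n τ k ε * NN n) x y = if y.1 = τ x.1 ∧ (x.2 : ℕ) + y.2 + k x.1 = n x.1 + n y.1
      then ε x.1 * (-1) ^ (x.2 : ℕ) else 0 := by
  obtain ⟨i, a⟩ := x
  obtain ⟨j, b⟩ := y
  dsimp only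
  have ha := a.isLt
  have hb := b.isLt
  rw [Matrix.mul_apply]
  split_ifs with h
  · have hkj : k i ≤ n j := by
      have h1 := hk j
      rw [h.1, hkτ] at h1
      rw [h.1]; exact h1
    have hb1 : 1 ≤ (b : ℕ) := by
      have := h.2; by_contra hc
      omega
    rw [Finset.sum_eq_single ⟨j, ⟨b - 1, by omega⟩⟩]
    · have c1 : (a : ℕ) + (b - 1) + k i + 1 = n i + n j := by omega
      have c2 : (b : ℕ) = b - 1 + 1 := by omega
      have e1 : bmat n τ k ε ⟨i, a⟩ ⟨j, ⟨b - 1, by omega⟩⟩ = ε i * (-1) ^ (a : ℕ) :=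
        if_pos ⟨h.1, c1⟩
      have e2 : NN n ⟨j, ⟨b - 1, by omega⟩⟩ ⟨j, b⟩ = 1 := if_pos ⟨rfl, c2⟩
      rw [e1, e2, mul_one]
    · rintro ⟨j', c⟩ _ hz
      have : ¬ (j' = j ∧ (b : ℕ) = c + 1) := by
        rintro ⟨rfl, h2⟩
        apply hz
        congr 1
        exact Fin.ext (by simp; omega)
      simp only [NN, Matrix.of_apply]
      rw [if_neg this, mul_zero]
    · simp
  · refine Finset.sum_eq_zero ?_
    rintro ⟨j', c⟩ _
    simp only [bmat, NN, Matrix.of_apply]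
    by_cases h1 : j' = j ∧ (b : ℕ) = c + 1
    · obtain ⟨rfl, h1⟩ := h1
      rw [if_neg, zero_mul]
      rintro ⟨h2, h3⟩
      exact h ⟨h2, by omega⟩
    · rw [if_neg h1, mul_zero]

theorem NN_mul_bmat (n : Fin p → ℕ) (τ : Fin p → Fin p) (k : Fin p → ℕ) (ε : Fin p → ℝ)
    (hk : ∀ i, k i ≤ n i) (x y : Σ i, Fin (n i)) :
    ((NN n)ᵀ * bmat n τ k ε) x y = if y.1 = τ x.1 ∧ (x.2 : ℕ) + y.2 + k x.1 = n x.1 + n y.1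
      then - (ε x.1 * (-1) ^ (x.2 : ℕ)) else 0 := by
  obtain ⟨i, a⟩ := x
  obtain ⟨j, b⟩ := y
  dsimp only
  have ha := a.isLt
  have hb := b.isLt
  rw [Matrix.mul_apply]
  split_ifs with h
  · have hki := hk i
    have ha1 : 1 ≤ (a : ℕ) := by
      have := h.2; by_contra hc
      omega
    rw [Finset.sum_eq_single ⟨i, ⟨a - 1, by omega⟩⟩]
    · have c1 : ((a : ℕ) - 1) + b + k i + 1 = n i + n j := by omega
      have c2 : (a : ℕ) = a - 1 + 1 := by omega
      have e1 : bmat n τ k ε ⟨i, ⟨a - 1, by omega⟩⟩ ⟨j, b⟩ = ε i * (-1) ^ ((a : ℕ) - 1) :=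
        if_pos ⟨h.1, c1⟩
      have e2 : (NN n)ᵀ ⟨i, a⟩ ⟨i, ⟨a - 1, by omega⟩⟩ = 1 := if_pos ⟨rfl, c2⟩
      have e3 : (-1 : ℝ) ^ (a : ℕ) = (-1) ^ ((a : ℕ) - 1) * (-1) := by
        rw [← pow_succ, ← c2]
      rw [e1, e2, one_mul, e3]
      ring
    · rintro ⟨j', c⟩ _ hz
      have : ¬ (j' = i ∧ (a : ℕ) = c + 1) := by
        rintro ⟨rfl, h2⟩
        apply hz
        congr 1
        exact Fin.ext (by simp; omega)
      simp only [NN, Matrix.of_apply, Matrix.transpose_apply]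
      rw [if_neg this, zero_mul]
    · simp
  · refine Finset.sum_eq_zero ?_
    rintro ⟨j', c⟩ _
    simp only [bmat, NN, Matrix.of_apply, Matrix.transpose_apply]
    by_cases h1 : j' = i ∧ (a : ℕ) = c + 1
    · obtain ⟨rfl, h1⟩ := h1
      rw [if_neg (c := j = τ j' ∧ _), mul_zero]
      rintro ⟨h2, h3⟩
      exact h ⟨h2, by omega⟩
    · rw [if_neg h1, zero_mul]

theorem bmat_eqn (n : Fin p → ℕ) (lam : Fin p → ℝ) (τ : Fin p → Fin p) (k : Fin p → ℕ)
    (ε : Fin p → ℝ) (hk : ∀ i, k i ≤ n i) (hkτ : ∀ i, k (τ i) = k i)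
    (hl : ∀ i, k i ≠ 0 → lam (τ i) = - lam i) :
    bmat n τ k ε * (EE n lam + NN n) + (EE n lam + NN n)ᵀ * bmat n τ k ε = 0 := by
  have h1 : bmat n τ k ε * EE n lam + EE n lam * bmat n τ k ε = 0 := by
    ext x y
    simp only [EE, Matrix.add_apply, Matrix.mul_diagonal, Matrix.diagonal_mul, Matrix.zero_apply]
    simp only [bmat, Matrix.of_apply]
    split_ifs with h
    · have := hl x.1 (by have := x.2.isLt; have := y.2.isLt; omega)
      rw [h.1, this]; ring
    · ring
  have h2 : bmat n τ k ε * NN n + (NN n)ᵀ * bmat n τ k ε = 0 := by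
    ext x y
    rw [Matrix.add_apply, bmat_mul_NN n τ k ε hk hkτ, NN_mul_bmat n τ k ε hk, Matrix.zero_apply]
    split_ifs <;> ring
  have h3 : (EE n lam)ᵀ = EE n lam := by simp [EE]
  rw [Matrix.mul_add, Matrix.transpose_add, Matrix.add_mul, h3]
  calc _ = (bmat n τ k ε * EE n lam + EE n lam * bmat n τ k ε) +
        (bmat n τ k ε * NN n + (NN n)ᵀ * bmat n τ k ε) := by abel
    _ = 0 := by rw [h1, h2, add_zero]

theorem bmat_skew (n : Fin p → ℕ) (τ : Fin p → Fin p) (k : Fin p → ℕ)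
    (ε : Fin p → ℝ) (hτ : ∀ i, τ (τ i) = i) (hkτ : ∀ i, k (τ i) = k i)
    (hε : ∀ i, ε (τ i) = ε i * (-1) ^ (n i + n (τ i) + k i)) :
    (bmat n τ k ε)ᵀ = - bmat n τ k ε := by
  ext ⟨i, a⟩ ⟨j, b⟩
  simp only [bmat, Matrix.transpose_apply, Matrix.neg_apply, Matrix.of_apply]
  by_cases h : j = τ i ∧ (a : ℕ) + b + k i + 1 = n i + n j
  · obtain ⟨rfl, h⟩ := h
    rw [if_pos (c := i = τ (τ i) ∧ _) ⟨(hτ i).symm, by rw [hkτ]; omega⟩, if_pos ⟨rfl, h⟩, hε, ← h,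
      show (a : ℕ) + b + k i + 1 + k i = a + b + 2 * k i + 1 by ring, pow_succ, pow_add, pow_add,
      pow_mul]
    have : ((-1 : ℝ) ^ (b : ℕ)) * (-1) ^ (b : ℕ) = 1 := by rw [← mul_pow]; simp
    simp only [even_two, Even.neg_pow, one_pow, mul_one]
    linear_combination (-(ε i * (-1) ^ (a : ℕ))) * this
  · rw [if_neg h, if_neg, neg_zero]
    rintro ⟨rfl, h2⟩
    exact h ⟨(hτ j).symm, by rw [hkτ]; omega⟩

theorem bmat_rank (n : Fin p → ℕ) (τ : Fin p → Fin p) (k : Fin p → ℕ)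
    (ε : Fin p → ℝ) (hτ : ∀ i, τ (τ i) = i) (hk : ∀ i, k i ≤ n i) (hkτ : ∀ i, k (τ i) = k i)
    (hε : ∀ i, ε i * ε i = 1) : (bmat n τ k ε).rank = ∑ i, k i := by
  classical
  have hd : bmat n τ k ε * (bmat n τ k ε)ᵀ =
      Matrix.diagonal fun x => if n x.1 ≤ (x.2 : ℕ) + k x.1 then (1 : ℝ) else 0 := by
    ext ⟨i, a⟩ ⟨i', a'⟩
    rw [Matrix.mul_apply, Matrix.diagonal_apply]
    by_cases hxy : (⟨i, a⟩ : Σ i, Fin (n i)) = ⟨i', a'⟩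
    · rw [if_pos hxy, ← hxy]
      simp only [Matrix.transpose_apply]
      have ha := a.isLt
      have hkj : k i ≤ n (τ i) := by rw [← hkτ]; exact hk _
      by_cases h : n i ≤ (a : ℕ) + k i
      · rw [if_pos h, Finset.sum_eq_single ⟨τ i, ⟨n i + n (τ i) - (a + k i + 1), by omega⟩⟩]
        · have e1 : bmat n τ k ε ⟨i, a⟩ ⟨τ i, ⟨n i + n (τ i) - (a + k i + 1), by omega⟩⟩ =
              ε i * (-1) ^ (a : ℕ) := if_pos ⟨rfl, by dsimp only; omega⟩
          rw [e1]
          have : ((-1 : ℝ) ^ (a : ℕ)) * (-1) ^ (a : ℕ) = 1 := by rw [← mul_pow]; simp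
          linear_combination (ε i * ε i) * this + hε i
        · rintro ⟨j, b⟩ _ hz
          have : ¬ (j = τ i ∧ (a : ℕ) + b + k i + 1 = n i + n j) := by
            rintro ⟨rfl, h2⟩
            apply hz
            congr 1
            exact Fin.ext (by simp; omega)
          simp only [bmat, Matrix.of_apply]
          rw [if_neg this, zero_mul]
        · simp
      · rw [if_neg h]
        refine Finset.sum_eq_zero ?_
        rintro ⟨j, b⟩ _
        have hb := b.isLt
        simp only [bmat, Matrix.of_apply]
        rw [if_neg, zero_mul]
        rintro ⟨h1, h2⟩
        omega
    · rw [if_neg hxy]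
      refine Finset.sum_eq_zero ?_
      rintro ⟨j, b⟩ _
      simp only [bmat, Matrix.of_apply, Matrix.transpose_apply]
      by_cases h1 : j = τ i ∧ (a : ℕ) + b + k i + 1 = n i + n j
      · rw [if_neg (c := j = τ i' ∧ _), mul_zero]
        rintro ⟨h2, h3⟩
        apply hxy
        have : i = i' := by rw [← hτ i, ← h1.1, h2, hτ]
        subst this
        congr 1
        exact Fin.ext (by omega)
      · rw [if_neg h1, zero_mul]
  rw [← Matrix.rank_self_mul_transpose, hd, Matrix.rank_diagonal, Fintype.card_subtype]
  simp only [ne_eq, ite_eq_right_iff, one_ne_zero, imp_false, not_not]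
  rw [Finset.card_filter, Fintype.sum_sigma]
  refine Finset.sum_congr rfl fun i _ => ?_
  dsimp only
  rw [Fin.sum_univ_eq_sum_range (fun a => if n i ≤ a + k i then 1 else 0) (n i),
    ← Finset.card_filter]
  have : (Finset.range (n i)).filter (fun a => n i ≤ a + k i) = Finset.Ico (n i - k i) (n i) := by
    ext a; simp only [Finset.mem_filter, Finset.mem_range, Finset.mem_Ico]; omega
  rw [this, Nat.card_Ico]
  have := hk i
  omega

theorem Ach_matrix (n : Fin p → ℕ) (lam : Fin p → ℝ) (S : Finset (Fin p)) (M : ℕ)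
    (h : Ach n lam S M) : ∃ B : Matrix (Σ i, Fin (n i)) (Σ i, Fin (n i)) ℝ, Bᵀ = -B ∧
      B * (EE n lam + NN n) + (EE n lam + NN n)ᵀ * B = 0 ∧ B.rank = M := by
  obtain ⟨τ, k, h1, h2, h3, h4, h5, h6, h7⟩ := h
  set ε : Fin p → ℝ := fun i => if i ≤ τ i then 1 else (-1) ^ (n i + n (τ i) + k i) with hε
  refine ⟨bmat n τ k ε, bmat_skew n τ k ε h1 h2 ?_, bmat_eqn n lam τ k ε h3 h2 h4, ?_⟩
  · intro i
    simp only [hε, h1, h2]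
    have hsq : ∀ q : ℕ, ((-1 : ℝ) ^ q) * (-1) ^ q = 1 := fun q => by rw [← mul_pow]; simp
    rcases lt_trichotomy i (τ i) with hlt | heq | hgt
    · rw [if_neg (not_le.2 hlt), if_pos hlt.le, one_mul, add_comm (n (τ i))]
    · rw [← heq]
      have : Even (n i + n i + k i) := (Even.add_self _).add (h5 i heq.symm)
      simp [this.neg_one_pow]
    · rw [if_pos hgt.le, if_neg (not_le.2 hgt), hsq]
  · rw [bmat_rank n τ k ε h1 h3 h2, h7]
    intro i
    simp only [hε]
    split_ifs
    · simp
    · rw [← mul_pow]; simp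

end construct

/-- Existence of skew-symmetric solutions of `B𝒥 + 𝒥ᵀB = 0` of even rank `K`
(real-eigenvalue Jordan case): possible exactly when `K ≤ N - δ`. -/
theorem exists_rank_iff_real
    (p : ℕ) (hp : 1 ≤ p) (n : Fin p → ℕ) (hn : ∀ i, 1 ≤ n i) (lam : Fin p → ℝ)
    (K : ℕ) (hK : Even K) :
    (∃ B : Matrix (Σ i, Fin (n i)) (Σ i, Fin (n i)) ℝ,
        Bᵀ = -B ∧
        B * Matrix.blockDiagonal' (fun i => jordanBlock (n i) (lam i))
          + (Matrix.blockDiagonal' (fun i => jordanBlock (n i) (lam i)))ᵀ * B = 0 ∧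
        B.rank = K) ↔
      K ≤ (∑ i, n i) - deltaReal p n lam := by
  rw [J_eq]
  constructor
  · rintro ⟨B, hB, h, hr⟩
    have := upper_bound n lam B hB h
    omega
  · intro hle
    obtain ⟨M, hM, hM'⟩ := Ach_total n lam
    exact Ach_matrix n lam _ K (Ach_le M hM K hK (by omega))
end
end

section
/- Let r, s ≥ 1, let a, b ∈ ℝ with b ≠ 0, and let X : Matrix (Fin r × Fin 2) (Fin s × Fin 2) ℝ. For i : Fin r and j : Fin s, write X_{ij} for the 2×2 block (X_{ij}) k l := X (i,k) (j,l). Then X * C_s(a,b) = C_r(a,b) * X if and only if all of the following hold: (i) for all i, j, the block X_{ij} commutes with J₂ := [[0,1],[−1,0]]; (ii) X_{ij} = 0 whenever (j:ℕ) + min r s < (i:ℕ) + s; and (iii) X_{i'j'} = X_{ij} whenever (i':ℕ) = (i:ℕ) + 1 ≤ r − 1 and (j':ℕ) = (j:ℕ) + 1 ≤ s − 1 (i.e. X is a 2-upper Toeplitz matrix each of whose 2×2 blocks commutes with J₂). -/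
open Matrix

noncomputable section

/-- The `2×2` block of `X` in block position `(i,j)`. -/
def blk {r s : ℕ} (X : Matrix (Fin r × Fin 2) (Fin s × Fin 2) ℝ)
    (i : Fin r) (j : Fin s) : Matrix (Fin 2) (Fin 2) ℝ :=
  Matrix.of fun k l => X (i, k) (j, l)

/-- commutator with `J₂` -/
def TJ (M : Matrix (Fin 2) (Fin 2) ℝ) : Matrix (Fin 2) (Fin 2) ℝ :=
  M * !![(0 : ℝ), 1; -1, 0] - !![(0 : ℝ), 1; -1, 0] * M

lemma TJ_TJ (M : Matrix (Fin 2) (Fin 2) ℝ) (h : TJ (TJ M) = 0) : TJ M = 0 := by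
  have h00 := congrFun (congrFun h 0) 0
  have h01 := congrFun (congrFun h 0) 1
  have h10 := congrFun (congrFun h 1) 0
  have h11 := congrFun (congrFun h 1) 1
  simp [TJ, Matrix.mul_apply, Fin.sum_univ_two, -Matrix.cons_mul] at h00 h01 h10 h11
  ext k l
  fin_cases k <;> fin_cases l <;> simp [TJ, Matrix.mul_apply, Fin.sum_univ_two, -Matrix.cons_mul] <;> linarith

/-- zero-extended blocks, with column index shifted by one -/
def ZB {r s : ℕ} (X : Matrix (Fin r × Fin 2) (Fin s × Fin 2) ℝ) (i : ℕ) :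
    ℕ → Matrix (Fin 2) (Fin 2) ℝ
  | 0 => 0
  | j + 1 => if h : i < r ∧ j < s then blk X ⟨i, h.1⟩ ⟨j, h.2⟩ else 0

lemma ZB_fin {r s : ℕ} (X : Matrix (Fin r × Fin 2) (Fin s × Fin 2) ℝ) (i : Fin r) (j : Fin s) :
    ZB X i (j + 1) = blk X i j := by
  simp [ZB]

lemma mul_left_entry {r s : ℕ} (a b : ℝ) (X : Matrix (Fin r × Fin 2) (Fin s × Fin 2) ℝ)
    (i : Fin r) (j : Fin s) (k l : Fin 2) :
    (X * realJordanBlock s a b) (i, k) (j, l)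
      = (blk X i j * !![a, b; -b, a]) k l + ZB X i j k l := by
  rw [Matrix.mul_apply, Fintype.sum_prod_type]
  have h1 : ∀ q : Fin s, (∑ y : Fin 2, X (i, k) (q, y) * realJordanBlock s a b (q, y) (j, l))
      = (if j = q then (blk X i q * !![a, b; -b, a]) k l else 0)
        + (if (j : ℕ) = (q : ℕ) + 1 then blk X i q k l else 0) := by
    intro q
    by_cases h : j = q
    · subst h
      simp [realJordanBlock, Matrix.mul_apply, blk]
    · by_cases h2 : (j : ℕ) = (q : ℕ) + 1
      · simp [realJordanBlock, h, h2, Matrix.one_apply, blk]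
      · simp [realJordanBlock, h, h2]
  simp_rw [h1]
  rw [Finset.sum_add_distrib, Finset.sum_ite_eq]
  simp only [Finset.mem_univ, if_true]
  congr 1
  obtain ⟨j, hj⟩ := j
  cases j with
  | zero => simp [ZB]
  | succ j =>
    rw [Finset.sum_eq_single (⟨j, by omega⟩ : Fin s)]
    · have : j < s := by omega
      simp [ZB, this]
    · intro q _ hq
      rw [if_neg]
      intro h
      apply hq
      ext
      simp at h
      simp [h]
    · simp

lemma mul_right_entry {r s : ℕ} (a b : ℝ) (X : Matrix (Fin r × Fin 2) (Fin s × Fin 2) ℝ)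
    (i : Fin r) (j : Fin s) (k l : Fin 2) :
    (realJordanBlock r a b * X) (i, k) (j, l)
      = (!![a, b; -b, a] * blk X i j) k l + ZB X (i + 1) (j + 1) k l := by
  rw [Matrix.mul_apply, Fintype.sum_prod_type]
  have h1 : ∀ q : Fin r, (∑ y : Fin 2, realJordanBlock r a b (i, k) (q, y) * X (q, y) (j, l))
      = (if q = i then (!![a, b; -b, a] * blk X q j) k l else 0)
        + (if (q : ℕ) = (i : ℕ) + 1 then blk X q j k l else 0) := by
    intro q
    by_cases h : q = i
    · subst h
      simp [realJordanBlock, Matrix.mul_apply, blk]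
    · by_cases h2 : (q : ℕ) = (i : ℕ) + 1
      · simp [realJordanBlock, h, h2, Matrix.one_apply, blk]
      · simp [realJordanBlock, h, h2]
  simp_rw [h1]
  rw [Finset.sum_add_distrib, Finset.sum_ite_eq']
  simp only [Finset.mem_univ, if_true]
  congr 1
  by_cases hi : (i : ℕ) + 1 < r
  · rw [Finset.sum_eq_single (⟨i + 1, hi⟩ : Fin r)]
    · simp [ZB, hi]
    · intro q _ hq
      rw [if_neg]
      intro h
      apply hq
      ext
      simp [h]
    · simp
  · rw [Finset.sum_eq_zero]
    · simp [ZB, hi]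
    · intro q _
      rw [if_neg]
      omega

lemma comm_iff_ZB {r s : ℕ} (a b : ℝ) (X : Matrix (Fin r × Fin 2) (Fin s × Fin 2) ℝ) :
    X * realJordanBlock s a b = realJordanBlock r a b * X ↔
    ∀ i j : ℕ, i < r → j < s → b • TJ (ZB X i (j + 1)) = ZB X (i + 1) (j + 1) - ZB X i j := by
  have key : ∀ (M P Q : Matrix (Fin 2) (Fin 2) ℝ) (k l : Fin 2),
      (b • TJ M) k l = (M * !![a, b; -b, a]) k l - (!![a, b; -b, a] * M) k l := by
    intro M P Q k l
    fin_cases k <;> fin_cases l <;> simp [TJ, Matrix.mul_apply, Fin.sum_univ_two, -Matrix.cons_mul] <;> ring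
  constructor
  · intro h i j hi hj
    ext k l
    have e := congrFun (congrFun h (⟨i, hi⟩, k)) (⟨j, hj⟩, l)
    rw [mul_left_entry, mul_right_entry] at e
    rw [key _ 0 0, ZB_fin X ⟨i, hi⟩ ⟨j, hj⟩, Matrix.sub_apply]
    simp only at e
    linarith
  · intro h
    ext ⟨i, k⟩ ⟨j, l⟩
    have e := congrFun (congrFun (h i j i.2 j.2) k) l
    rw [key _ 0 0, ZB_fin X i j, Matrix.sub_apply] at e
    rw [mul_left_entry, mul_right_entry]
    linarith

/-- A matrix intertwines two real Jordan blocks `C_s(a,b)`, `C_r(a,b)` iff it is a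
`2`-upper-Toeplitz matrix whose `2×2` blocks commute with `J₂ = [[0,1],[-1,0]]`. -/
theorem complex_jordan_commutation_iff
    (r s : ℕ) (hr : 1 ≤ r) (hs : 1 ≤ s) (a b : ℝ) (hb : b ≠ 0)
    (X : Matrix (Fin r × Fin 2) (Fin s × Fin 2) ℝ) :
    X * realJordanBlock s a b = realJordanBlock r a b * X ↔
      ((∀ (i : Fin r) (j : Fin s),
          blk X i j * !![(0 : ℝ), 1; -1, 0] = !![(0 : ℝ), 1; -1, 0] * blk X i j) ∧
       (∀ (i : Fin r) (j : Fin s), (j : ℕ) + min r s < (i : ℕ) + s → blk X i j = 0) ∧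
       (∀ (i i' : Fin r) (j j' : Fin s),
          (i' : ℕ) = (i : ℕ) + 1 → (j' : ℕ) = (j : ℕ) + 1 → blk X i' j' = blk X i j)) := by
  rw [comm_iff_ZB]
  have hT0 : TJ 0 = 0 := by simp [TJ]
  have hTs : ∀ A B, TJ (A - B) = TJ A - TJ B := by
    intro A B; simp only [TJ, Matrix.sub_mul, Matrix.mul_sub]; abel
  have hTb : ∀ A, TJ (b • A) = b • TJ A := by
    intro A; simp [TJ, smul_sub]
  have hZr : ∀ i j, r ≤ i → ZB X i j = 0 := by
    intro i j h
    cases j with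
    | zero => rfl
    | succ j => 
      have : ¬ i < r := by omega
      simp [ZB, this]
  constructor
  · intro h
    have hT : ∀ n i j : ℕ, i < r → j ≤ s → r - i + j = n → TJ (ZB X i j) = 0 := by
      intro n
      induction n using Nat.strong_induction_on with
      | _ n ih =>
        intro i j hi hj hn
        cases j with
        | zero => simpa [ZB] using hT0
        | succ j =>
          apply TJ_TJ
          have e := congrArg TJ (h i j hi (by omega))
          rw [hTb, hTs, ih (r - i + j) (by omega) i j hi (by omega) rfl] at e
          have e2 : TJ (ZB X (i + 1) (j + 1)) = 0 := by
            by_cases hi' : i + 1 < r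
            · exact ih (r - (i + 1) + (j + 1)) (by omega) _ _ hi' hj rfl
            · rw [hZr _ _ (by omega), hT0]
          rw [e2, sub_zero] at e
          exact (smul_eq_zero.mp e).resolve_left hb
    have hS : ∀ i j, i < r → j < s → ZB X (i + 1) (j + 1) = ZB X i j := by
      intro i j hi hj
      have e := h i j hi hj
      rw [hT _ i (j + 1) hi (by omega) rfl, smul_zero] at e
      exact sub_eq_zero.mp e.symm
    refine ⟨?_, ?_, ?_⟩
    · intro i j
      have e := hT _ i (j + 1) i.2 (by omega) rfl
      rw [ZB_fin] at e
      exact sub_eq_zero.mp e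
    · intro i j hij
      rw [← ZB_fin]
      by_cases hrs : r ≤ s
      · rw [min_eq_left hrs] at hij
        have down : ∀ n i j : ℕ, i + n = r → j + n ≤ s → ZB X i j = 0 := by
          intro n
          induction n with
          | zero => intro i j hi _; exact hZr _ _ (by omega)
          | succ n ih =>
            intro i j hi hj
            rw [← hS i j (by omega) (by omega)]
            exact ih _ _ (by omega) (by omega)
        exact down (r - i) _ _ (by omega) (by omega)
      · rw [min_eq_right (by omega)] at hij
        have up : ∀ j i : ℕ, j ≤ i → i ≤ r → j ≤ s → ZB X i j = 0 := by
          intro j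
          induction j with
          | zero => intros; rfl
          | succ j ih =>
            intro i hi hr' hj
            obtain ⟨i, rfl⟩ : ∃ m, i = m + 1 := ⟨i - 1, by omega⟩
            rw [hS i j (by omega) (by omega)]
            exact ih _ (by omega) (by omega) (by omega)
        exact up _ _ (by omega) (by omega) (by omega)
    · intro i i' j j' hi hj
      rw [← ZB_fin, ← ZB_fin, hi, hj]
      exact hS _ _ i.2 (by omega)
  · rintro ⟨h1, h2, h3⟩ i j hi hj
    have e1 : TJ (ZB X i (j + 1)) = 0 := by
      rw [ZB_fin X ⟨i, hi⟩ ⟨j, hj⟩]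
      exact sub_eq_zero.mpr (h1 _ _)
    rw [e1, smul_zero, eq_comm, sub_eq_zero]
    cases j with
    | zero =>
      by_cases hi' : i + 1 < r
      · rw [ZB_fin X ⟨i + 1, hi'⟩ ⟨0, hj⟩, h2 _ _ (by simp only; omega)]
        rfl
      · rw [hZr _ _ (by omega)]
        rfl
    | succ j =>
      rw [ZB_fin X ⟨i, hi⟩ ⟨j, by omega⟩]
      by_cases hi' : i + 1 < r
      · rw [ZB_fin X ⟨i + 1, hi'⟩ ⟨j + 1, hj⟩]
        exact h3 _ _ _ _ rfl rfl
      · rw [hZr _ _ (by omega), h2 _ _ (by simp only; omega)]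
end
end

section
/- Let r, s ≥ 1, let a, b ∈ ℝ with b ≠ 0, and let X : Matrix (Fin r × Fin 2) (Fin s × Fin 2) ℝ. For i : Fin r and j : Fin s, write X_{ij} for the 2×2 block (X_{ij}) k l := X (i,k) (j,l). Then X * C_s(a,b) + (C_r(−a,b))ᵀ * X = 0 if and only if all of the following hold: (i) for all i, j, the block X_{ij} commutes with J₂ := [[0,1],[−1,0]]; (ii) X_{ij} = 0 whenever (i:ℕ) + (j:ℕ) + 2 ≤ max r s; and (iii) X_{i'j} = −X_{ij'} whenever (i':ℕ) = (i:ℕ) + 1 ≤ r − 1 and (j':ℕ) = (j:ℕ) + 1 ≤ s − 1 (i.e. X is a 2-upper alternating Hankel-type solution whose 2×2 blocks commute with J₂). -/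
open Matrix

noncomputable section

/-- block to the left -/
def lblk {r s : ℕ} (X : Matrix (Fin r × Fin 2) (Fin s × Fin 2) ℝ)
    (i : Fin r) (j : Fin s) : Matrix (Fin 2) (Fin 2) ℝ :=
  if h : 0 < (j : ℕ) then blk X i ⟨j - 1, by omega⟩ else 0

/-- block above -/
def ublk {r s : ℕ} (X : Matrix (Fin r × Fin 2) (Fin s × Fin 2) ℝ)
    (i : Fin r) (j : Fin s) : Matrix (Fin 2) (Fin 2) ℝ :=
  if h : 0 < (i : ℕ) then blk X ⟨i - 1, by omega⟩ j else 0

lemma sum_pred {s : ℕ} (j : Fin s) (f : Fin s → ℝ) :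
    (∑ m : Fin s, if (j : ℕ) = (m : ℕ) + 1 then f m else 0) =
      if h : 0 < (j : ℕ) then f ⟨j - 1, by omega⟩ else 0 := by
  split_ifs with h
  · rw [Finset.sum_eq_single ⟨j - 1, by omega⟩]
    · rw [if_pos]; simp only; omega
    · intro m _ hm
      rw [if_neg]
      intro h2; apply hm; ext; simp only; omega
    · simp
  · apply Finset.sum_eq_zero
    intro m _
    rw [if_neg]; omega

lemma mul_entry {r s : ℕ} (X : Matrix (Fin r × Fin 2) (Fin s × Fin 2) ℝ) (a b : ℝ)
    (i : Fin r) (j : Fin s) (k l : Fin 2) :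
    (X * realJordanBlock s a b) (i, k) (j, l) =
      (blk X i j * !![a, b; -b, a]) k l + lblk X i j k l := by
  have h1 : lblk X i j k l = ∑ m : Fin s, if (j : ℕ) = (m : ℕ) + 1 then X (i, k) (m, l) else 0 := by
    rw [sum_pred, lblk]
    split_ifs <;> simp [blk]
  have h2 : (blk X i j * !![a, b; -b, a]) k l =
      ∑ m : Fin s, if m = j then (blk X i j * !![a, b; -b, a]) k l else 0 := by simp
  rw [h1, h2, ← Finset.sum_add_distrib, Matrix.mul_apply, Fintype.sum_prod_type]
  refine Finset.sum_congr rfl fun m _ => ?_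
  by_cases hm : m = j
  · subst hm
    simp [realJordanBlock, blk, Matrix.mul_apply]
  · have hm' : ¬ j = m := fun h => hm h.symm
    by_cases h3 : (j : ℕ) = (m : ℕ) + 1
    · simp only [realJordanBlock, Matrix.of_apply, hm, hm', h3, if_true, if_false]
      simp [Matrix.one_apply]
    · simp [realJordanBlock, hm, hm', h3]

lemma tmul_entry {r s : ℕ} (X : Matrix (Fin r × Fin 2) (Fin s × Fin 2) ℝ) (a b : ℝ)
    (i : Fin r) (j : Fin s) (k l : Fin 2) :
    ((realJordanBlock r a b)ᵀ * X) (i, k) (j, l) =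
      ((!![a, b; -b, a])ᵀ * blk X i j) k l + ublk X i j k l := by
  have h := mul_entry Xᵀ a b j i l k
  have e : ((realJordanBlock r a b)ᵀ * X) (i, k) (j, l) =
      (Xᵀ * realJordanBlock r a b) (j, l) (i, k) := by
    rw [← Matrix.transpose_apply (Xᵀ * realJordanBlock r a b), Matrix.transpose_mul,
      Matrix.transpose_transpose]
  rw [e, h]
  congr 1
  · simp [Matrix.mul_apply, blk, mul_comm]
  · unfold lblk ublk
    split_ifs <;> simp [blk]

lemma eq_iff {r s : ℕ} (X : Matrix (Fin r × Fin 2) (Fin s × Fin 2) ℝ) (a b : ℝ) :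
    X * realJordanBlock s a b + (realJordanBlock r (-a) b)ᵀ * X = 0 ↔
    ∀ i j, b • (blk X i j * !![(0 : ℝ), 1; -1, 0] - !![(0 : ℝ), 1; -1, 0] * blk X i j)
      + (lblk X i j + ublk X i j) = 0 := by
  have key : ∀ i j k l, (X * realJordanBlock s a b + (realJordanBlock r (-a) b)ᵀ * X) (i, k) (j, l)
      = (b • (blk X i j * !![(0 : ℝ), 1; -1, 0] - !![(0 : ℝ), 1; -1, 0] * blk X i j)
      + (lblk X i j + ublk X i j)) k l := by
    intro i j k l
    rw [Matrix.add_apply, mul_entry, tmul_entry]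
    simp only [Matrix.add_apply, Matrix.smul_apply, Matrix.sub_apply, Matrix.mul_apply,
      Fin.sum_univ_two]
    fin_cases k <;> fin_cases l <;> simp <;> ring
  constructor
  · intro h i j
    ext k l
    rw [← key, h]; rfl
  · intro h
    ext ⟨i, k⟩ ⟨j, l⟩
    rw [key, h]; rfl

lemma comm_aux (b : ℝ) (hb : b ≠ 0) (M N : Matrix (Fin 2) (Fin 2) ℝ)
    (hN : N * !![(0 : ℝ), 1; -1, 0] = !![(0 : ℝ), 1; -1, 0] * N)
    (h : b • (M * !![(0 : ℝ), 1; -1, 0] - !![(0 : ℝ), 1; -1, 0] * M) + N = 0) :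
    M * !![(0 : ℝ), 1; -1, 0] = !![(0 : ℝ), 1; -1, 0] * M := by
  have e := fun i j => congrFun (congrFun h i) j
  have f := fun i j => congrFun (congrFun hN i) j
  simp only [Fin.forall_fin_two, Matrix.add_apply, Matrix.smul_apply, Matrix.sub_apply,
    Matrix.mul_apply, Fin.sum_univ_two] at e f
  simp at e f
  obtain ⟨⟨e1, e2⟩, e3, e4⟩ := e
  obtain ⟨⟨f1, f2⟩, f3, f4⟩ := f
  have g1 : M 0 1 + M 1 0 = 0 := by
    apply mul_left_cancel₀ hb; linarith
  have g2 : M 0 0 - M 1 1 = 0 := by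
    apply mul_left_cancel₀ hb; linarith
  ext i j
  fin_cases i <;> fin_cases j <;> simp [Matrix.mul_apply, Fin.sum_univ_two] <;> linarith

/-- Solutions of `X C_s(a,b) + C_r(-a,b)ᵀ X = 0` are exactly the `2`-lower alternating
Hankel-type matrices whose `2×2` blocks commute with `J₂ = [[0,1],[-1,0]]`. -/
theorem complex_jordan_transpose_commutation_iff
    (r s : ℕ) (hr : 1 ≤ r) (hs : 1 ≤ s) (a b : ℝ) (hb : b ≠ 0)
    (X : Matrix (Fin r × Fin 2) (Fin s × Fin 2) ℝ) :
    X * realJordanBlock s a b + (realJordanBlock r (-a) b)ᵀ * X = 0 ↔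
      ((∀ (i : Fin r) (j : Fin s),
          blk X i j * !![(0 : ℝ), 1; -1, 0] = !![(0 : ℝ), 1; -1, 0] * blk X i j) ∧
       (∀ (i : Fin r) (j : Fin s), (i : ℕ) + (j : ℕ) + 2 ≤ max r s → blk X i j = 0) ∧
       (∀ (i i' : Fin r) (j j' : Fin s),
          (i' : ℕ) = (i : ℕ) + 1 → (j' : ℕ) = (j : ℕ) + 1 → blk X i' j = -(blk X i j'))) := by
  rw [eq_iff]
  constructor
  · intro h
    have hc : ∀ n : ℕ, ∀ (i : Fin r) (j : Fin s), (i : ℕ) + (j : ℕ) = n →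
          blk X i j * !![(0 : ℝ), 1; -1, 0] = !![(0 : ℝ), 1; -1, 0] * blk X i j := by
      intro n
      induction n using Nat.strong_induction_on with
      | _ n ih =>
        intro i j hn
        refine comm_aux b hb _ _ ?_ (h i j)
        rw [add_mul, mul_add]
        congr 1
        · unfold lblk
          split_ifs with h0
          · exact ih (n - 1) (by omega) _ _ (by simp only; omega)
          · simp
        · unfold ublk
          split_ifs with h0
          · exact ih (n - 1) (by omega) _ _ (by simp only; omega)
          · simp
    have hC := fun i j => hc _ i j rfl
    have h' : ∀ i j, lblk X i j + ublk X i j = 0 := by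
      intro i j
      have := h i j
      rwa [hC i j, sub_self, smul_zero, zero_add] at this
    have h3 : ∀ (i i' : Fin r) (j j' : Fin s),
          (i' : ℕ) = (i : ℕ) + 1 → (j' : ℕ) = (j : ℕ) + 1 → blk X i' j = -(blk X i j') := by
      intro i i' j j' hi hj
      have := h' i' j'
      unfold lblk ublk at this
      rw [dif_pos (by omega), dif_pos (by omega)] at this
      have e1 : (⟨(j' : ℕ) - 1, by omega⟩ : Fin s) = j := by ext; simp only; omega
      have e2 : (⟨(i' : ℕ) - 1, by omega⟩ : Fin r) = i := by ext; simp only; omega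
      rw [e1, e2] at this
      exact eq_neg_of_add_eq_zero_left this
    refine ⟨hC, ?_, h3⟩
    intro i j hij
    rcases le_total r s with hrs | hrs
    · rw [max_eq_right hrs] at hij
      obtain ⟨i, hi⟩ := i
      induction i generalizing j with
      | zero =>
        have := h' ⟨0, hi⟩ ⟨j + 1, by simp only at hij; omega⟩
        simpa [lblk, ublk] using this
      | succ i ih =>
        simp only at hij
        rw [h3 ⟨i, by omega⟩ ⟨i + 1, hi⟩ j ⟨j + 1, by omega⟩ rfl rfl, ih _ _ (by simp only; omega),
          neg_zero]
    · rw [max_eq_left hrs] at hij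
      obtain ⟨j, hj⟩ := j
      induction j generalizing i with
      | zero =>
        have := h' ⟨i + 1, by simp only at hij; omega⟩ ⟨0, hj⟩
        simpa [lblk, ublk] using this
      | succ j ih =>
        simp only at hij
        have := h3 i ⟨i + 1, by omega⟩ ⟨j, by omega⟩ ⟨j + 1, hj⟩ rfl rfl
        rw [ih _ _ (by simp only; omega)] at this
        exact neg_eq_zero.mp this.symm
  · rintro ⟨h1, h2, h3⟩ i j
    rw [h1 i j, sub_self, smul_zero, zero_add]
    unfold lblk ublk
    have := i.2
    have := j.2
    split_ifs with hj hi hi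
    · rw [h3 ⟨i - 1, by omega⟩ i ⟨j - 1, by omega⟩ j (by simp only; omega) (by simp only; omega)] <;> simp
    · rw [h2 _ _ (by simp only; omega), add_zero]
    · rw [h2 _ _ (by simp only; omega), add_zero]
    · simp
end
end

section
/- Let n ≥ 1. Let T be an n×n real upper-triangular Toeplitz matrix, i.e. T i j = 0 whenever (j:ℕ) < (i:ℕ) and T i j depends only on (j:ℕ) − (i:ℕ); let I± be the diagonal matrix with (I±) i i = (−1)^(i:ℕ); and set C := I± * T. Let P be the n×n exchange matrix, P i j = 1 if (i:ℕ) + (j:ℕ) = n − 1 and 0 otherwise. If P * Cᵀ * P = −C, then I± * C = C * I± when n is even, and I± * C = −(C * I±) when n is odd. -/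
open Matrix

/-- If `C = I± * T` with `T` upper-triangular Toeplitz, `I±` the alternating sign diagonal
matrix, and `C` satisfies `P Cᵀ P = -C` for the exchange matrix `P`, then `I±` commutes with
`C` when `n` is even and anticommutes with `C` when `n` is odd. -/
theorem alternating_identity_commutation
    (n : ℕ) (hn : 1 ≤ n) (T : Matrix (Fin n) (Fin n) ℝ)
    (htri : ∀ i j : Fin n, (j : ℕ) < (i : ℕ) → T i j = 0)
    (htoep : ∀ i i' j j' : Fin n,
      (j : ℕ) + (i' : ℕ) = (j' : ℕ) + (i : ℕ) → T i j = T i' j')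
    (Ipm : Matrix (Fin n) (Fin n) ℝ)
    (hIpm : Ipm = Matrix.diagonal fun i : Fin n => (-1 : ℝ) ^ (i : ℕ))
    (C : Matrix (Fin n) (Fin n) ℝ) (hC : C = Ipm * T)
    (P : Matrix (Fin n) (Fin n) ℝ)
    (hP : P = Matrix.of fun i j : Fin n =>
      if (i : ℕ) + (j : ℕ) = n - 1 then (1 : ℝ) else 0)
    (hpers : P * Cᵀ * P = -C) :
    (Even n → Ipm * C = C * Ipm) ∧ (Odd n → Ipm * C = -(C * Ipm)) := by
  have hPe : P = (Matrix.of fun i j : Fin n => if j = Fin.rev i then (1 : ℝ) else 0) := by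
    rw [hP]
    ext i j
    have h : ((i : ℕ) + (j : ℕ) = n - 1) ↔ j = Fin.rev i := by
      rw [Fin.ext_iff, Fin.val_rev]
      omega
    simp only [Matrix.of_apply, h]
  have hCe : ∀ i j, C i j = (-1 : ℝ) ^ (i : ℕ) * T i j := by
    intro i j
    rw [hC, hIpm, Matrix.diagonal_mul]
  have key : ∀ i j : Fin n,
      (-1 : ℝ) ^ (Fin.rev j : ℕ) * T i j = -((-1 : ℝ) ^ (i : ℕ) * T i j) := by
    intro i j
    have h := congrFun (congrFun hpers i) j
    have e : ∀ x : Fin n, (j = Fin.rev x) ↔ (x = Fin.rev j) := by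
      intro x
      constructor <;> (rintro rfl; simp)
    have ht : T (Fin.rev j) (Fin.rev i) = T i j := by
      apply htoep
      simp only [Fin.val_rev]
      omega
    simp only [hPe, Matrix.mul_apply, Matrix.of_apply, Matrix.transpose_apply, e, ite_mul, mul_ite,
      one_mul, zero_mul, mul_one, mul_zero, Finset.sum_ite_eq', Finset.mem_univ, if_true,
      Matrix.neg_apply, Finset.sum_ite_eq, hCe, ht] at h
    exact h
  have hr : ∀ j : Fin n, (-1 : ℝ) ^ (Fin.rev j : ℕ) * (-1 : ℝ) ^ (j : ℕ) * (-1) = (-1 : ℝ) ^ n := by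
    intro j
    rw [← pow_add, ← pow_succ]
    congr 1
    rw [Fin.val_rev]
    omega
  have hs : ∀ k : ℕ, (-1 : ℝ) ^ k * (-1 : ℝ) ^ k = 1 := by
    intro k
    rw [← mul_pow]
    simp
  have main : ∀ i j, (Ipm * C) i j = (-1 : ℝ) ^ n * (C * Ipm) i j := by
    intro i j
    rw [hIpm, Matrix.diagonal_mul, Matrix.mul_diagonal, hCe, ← hr j]
    linear_combination ((-1 : ℝ) ^ (i : ℕ)) * key i j +
      (-1 : ℝ) ^ (i : ℕ) * (-1 : ℝ) ^ (Fin.rev j : ℕ) * T i j * hs j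
  constructor
  · intro h
    ext i j
    rw [main, h.neg_one_pow, one_mul]
  · intro h
    ext i j
    rw [main, h.neg_one_pow, Matrix.neg_apply, neg_one_mul]
end
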